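/- arXiv:2308.11987 — 2 statements merged into one kernel-verified Lean document; each statement's English description precedes it below -/
import Mathlib

section
/- There is an absolute constant C > 0 such that for all y ≥ 2 one has ∏_{p < y}(1 + 1/p)^{-1} · ∑_{n ∈ S_{<y}} τ(n) · n^{1/Log y}/n ≤ C · Log y. -/
open Filter Topology
open scoped Classical

noncomputable def LLog (x : ℝ) : ℝ := max 1 (Real.log x)
noncomputable def LLog2 (x : ℝ) : ℝ := LLog (LLog x)
noncomputable def LLog3 (x : ℝ) : ℝ := LLog (LLog2 x)

/-- `Δ^{(v)}(n)`: the maximal number of divisors of `n` in an interval `(e^u, e^{u+v}]`. -/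
noncomputable def DeltaV (v : ℝ) (n : ℕ) : ℕ :=
  ⨆ u : ℝ, (n.divisors.filter fun d => Real.exp u < (d : ℝ) ∧ (d : ℝ) ≤ Real.exp (u + v)).card

/-- The Erdős–Hooley Delta function. -/
noncomputable def Delta (n : ℕ) : ℕ := DeltaV 1 n

/-- `S_{[y,x)}`: squarefree positive integers all of whose prime factors `p` satisfy `y ≤ p < x`. -/
def Sset (y x : ℝ) : Set ℕ :=
  {n | 0 < n ∧ Squarefree n ∧ ∀ p ∈ n.primeFactors, y ≤ (p : ℝ) ∧ (p : ℝ) < x}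

/-- `∏_{y ≤ p < x} (1 + 1/p)⁻¹`, product over primes. -/
noncomputable def primeProd (y x : ℝ) : ℝ :=
  ∏ᶠ p ∈ {p : ℕ | p.Prime ∧ y ≤ (p : ℝ) ∧ (p : ℝ) < x}, ((1 : ℝ) + 1 / p)⁻¹

/-- number of distinct prime factors -/
def omegaN (n : ℕ) : ℕ := n.primeFactors.card

/-- number of divisors -/
def tauN (n : ℕ) : ℕ := n.divisors.card

/-- `n_{<y}`: the largest divisor of `n` (squarefree) composed of primes `< y`. -/
noncomputable def nsmall (n : ℕ) (y : ℝ) : ℕ :=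
  ∏ p ∈ n.primeFactors.filter (fun p : ℕ => (p : ℝ) < y), p

def Yset (α x : ℝ) : Set ℝ :=
  {y | 0 < y ∧ |LLog2 y - α * LLog2 x| ≤ Real.sqrt (LLog2 x) ∧ ∃ m : ℤ, LLog2 y = m * Real.log 2}

def Uset (α x : ℝ) : Set ℤ :=
  {u | |(u : ℝ) - (Real.log 4 - 1) / Real.log 2 * (α * LLog2 x)| ≤ Real.sqrt (LLog2 x)}

noncomputable def Qfun (t : ℝ) : ℝ := t * Real.log t - t + 1

/-- Weak form of Mertens' first theorem (upper bound). -/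
theorem mertens_upper (N : ℕ) (hN : 1 ≤ N) :
    ∑ p ∈ (Finset.Ioc 0 N).filter Nat.Prime, Real.log p / p ≤ Real.log N + Real.log 4 := by
  have hN0 : (0 : ℝ) < N := by exact_mod_cast hN
  have h1 : ∑ p ∈ (Finset.Ioc 0 N).filter Nat.Prime, ((N / p : ℕ) : ℝ) * Real.log p
      ≤ N * Real.log N := by
    have e1 : ∀ p ∈ (Finset.Ioc 0 N).filter Nat.Prime, ((N / p : ℕ) : ℝ) * Real.log p
        = ∑ n ∈ Finset.Ioc 0 N, if p ∣ n then Real.log p else 0 := by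
      intro p _
      rw [← Finset.sum_filter, Finset.sum_const, Nat.Ioc_filter_dvd_card_eq_div, nsmul_eq_mul]
    rw [Finset.sum_congr rfl e1, Finset.sum_comm]
    have e2 : ∀ n ∈ Finset.Ioc 0 N,
        (∑ p ∈ (Finset.Ioc 0 N).filter Nat.Prime, if p ∣ n then Real.log p else 0)
          ≤ Real.log N := by
      intro n hn
      rw [Finset.mem_Ioc] at hn
      rw [← Finset.sum_filter]
      have hs : ((Finset.Ioc 0 N).filter Nat.Prime).filter (fun p => p ∣ n) = n.primeFactors := by
        ext p
        simp only [Finset.mem_filter, Finset.mem_Ioc, Nat.mem_primeFactors]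
        constructor
        · rintro ⟨⟨_, h2⟩, h3⟩
          exact ⟨h2, h3, by omega⟩
        · rintro ⟨h2, h3, _⟩
          exact ⟨⟨⟨h2.pos, (Nat.le_of_dvd hn.1 h3).trans hn.2⟩, h2⟩, h3⟩
      rw [hs, ← Real.log_prod (fun p hp => by
        have := (Nat.mem_primeFactors.1 hp).1.pos
        positivity)]
      rw [← Nat.cast_prod]
      have hpos : 0 < ∏ p ∈ n.primeFactors, p :=
        Nat.pos_of_dvd_of_pos (Nat.prod_primeFactors_dvd n) hn.1
      apply Real.log_le_log (by exact_mod_cast hpos)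
      exact_mod_cast (Nat.le_of_dvd hn.1 (Nat.prod_primeFactors_dvd n)).trans hn.2
    calc _ ≤ ∑ n ∈ Finset.Ioc 0 N, Real.log N := Finset.sum_le_sum e2
      _ = _ := by simp
  have h2 : ∑ p ∈ (Finset.Ioc 0 N).filter Nat.Prime, Real.log p ≤ Real.log 4 * N := by
    have := Chebyshev.theta_le_log4_mul_x (x := (N : ℝ)) hN0.le
    unfold Chebyshev.theta at this
    rwa [Nat.floor_natCast] at this
  have h3 : N * ∑ p ∈ (Finset.Ioc 0 N).filter Nat.Prime, Real.log p / p ≤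
      ∑ p ∈ (Finset.Ioc 0 N).filter Nat.Prime, ((N / p : ℕ) : ℝ) * Real.log p
      + ∑ p ∈ (Finset.Ioc 0 N).filter Nat.Prime, Real.log p := by
    rw [Finset.mul_sum, ← Finset.sum_add_distrib]
    apply Finset.sum_le_sum
    intro p hp
    have hp' := (Finset.mem_filter.1 hp).2
    have hp0 : (0 : ℝ) < p := by exact_mod_cast hp'.pos
    have hl : 0 ≤ Real.log p := Real.log_natCast_nonneg p
    have hd : (N : ℝ) / p ≤ (N / p : ℕ) + 1 := by
      rw [div_le_iff₀ hp0]
      have := Nat.lt_div_mul_add hp'.pos (a := N)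
      have h' : N ≤ (N / p + 1) * p := by
        rw [add_mul, one_mul]; exact this.le
      exact_mod_cast h'
    calc (N : ℝ) * (Real.log p / p) = N / p * Real.log p := by ring
      _ ≤ ((N / p : ℕ) + 1) * Real.log p := by gcongr
      _ = _ := by ring
  have h4 : N * ∑ p ∈ (Finset.Ioc 0 N).filter Nat.Prime, Real.log p / p
      ≤ N * (Real.log N + Real.log 4) := by linarith
  exact le_of_mul_le_mul_left h4 hN0

theorem zeta_partial (ε : ℝ) (hε : 0 < ε) (M : ℕ) :
    ∑ n ∈ Finset.range (M + 1), ((n + 1 : ℕ) : ℝ) ^ (-1 - ε)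
      ≤ 1 + (1 / ε) * (1 - ((M + 1 : ℕ) : ℝ) ^ (-ε)) := by
  induction M with
  | zero => simp
  | succ M ih =>
    rw [Finset.sum_range_succ]
    have hx : (0 : ℝ) < (M + 1 : ℕ) := by positivity
    have hy : (0 : ℝ) < (M + 1 + 1 : ℕ) := by positivity
    have hxy : ((M + 1 + 1 : ℕ) : ℝ) = (M + 1 : ℕ) + 1 := by push_cast; ring
    generalize ((M + 1 + 1 : ℕ) : ℝ) = y at *
    generalize ((M + 1 : ℕ) : ℝ) = x at *
    have key : y ^ (-1 - ε) ≤ (1 / ε) * (x ^ (-ε) - y ^ (-ε)) := by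
      have e1 : y ^ (-1 - ε) = y ^ (-ε) / y := by
        rw [show -1 - ε = -ε - 1 by ring, Real.rpow_sub_one hy.ne']
      have hl : Real.log x ≤ Real.log y - 1 / y := by
        have := Real.log_le_sub_one_of_pos (div_pos hx hy)
        rw [Real.log_div hx.ne' hy.ne'] at this
        have h2 : x / y - 1 = - (1 / y) := by
          field_simp; linarith
        linarith
      have e2 : y ^ (-ε) * (1 + ε / y) ≤ x ^ (-ε) := by
        rw [Real.rpow_def_of_pos hx, Real.rpow_def_of_pos hy]
        calc _ ≤ Real.exp (Real.log y * -ε) * Real.exp (ε / y) := by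
              gcongr
              linarith [Real.add_one_le_exp (ε / y)]
          _ = Real.exp (Real.log y * -ε + ε / y) := (Real.exp_add _ _).symm
          _ ≤ _ := by
              apply Real.exp_le_exp.2
              have h3 : Real.log x * ε ≤ (Real.log y - 1 / y) * ε := by gcongr
              have h4 : ε / y = 1 / y * ε := by ring
              nlinarith
      rw [e1, one_div, ← div_eq_inv_mul, le_div_iff₀ hε]
      have h5 : y ^ (-ε) / y * ε = y ^ (-ε) * (1 + ε / y) - y ^ (-ε) := by ring
      linarith
    linarith

noncomputable def smallPrimes (y : ℝ) : Finset ℕ := (Finset.range ⌈y⌉₊).filter Nat.Prime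

theorem mem_smallPrimes (y : ℝ) (p : ℕ) : p ∈ smallPrimes y ↔ p.Prime ∧ (p : ℝ) < y := by
  simp [smallPrimes, Nat.lt_ceil, and_comm]

theorem Sset_bij (y : ℝ) :
    Set.BijOn (fun t : Finset ℕ => ∏ p ∈ t, p) ((smallPrimes y).powerset : Set (Finset ℕ))
      (Sset 1 y) := by
  have hP : ∀ t ∈ ((smallPrimes y).powerset : Set (Finset ℕ)), ∀ p ∈ t, p.Prime := by
    intro t ht p hp
    exact ((mem_smallPrimes y p).1 (Finset.mem_powerset.1 (Finset.mem_coe.1 ht) hp)).1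
  refine ⟨?_, ?_, ?_⟩
  · intro t ht
    have hp := hP t ht
    refine ⟨Finset.prod_pos fun p h => (hp p h).pos, ?_, ?_⟩
    · apply Finset.squarefree_prod_of_pairwise_isCoprime
      · intro a ha b hb hab
        exact (Nat.coprime_iff_isRelPrime).1 ((Nat.coprime_primes (hp a ha) (hp b hb)).2 hab)
      · intro a ha
        exact (hp a ha).prime.squarefree
    · intro p h
      simp only [] at h
      rw [Nat.primeFactors_prod hp] at h
      have := (mem_smallPrimes y p).1 (Finset.mem_powerset.1 (Finset.mem_coe.1 ht) h)
      exact ⟨by exact_mod_cast this.1.one_le, this.2⟩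
  · intro s hs t ht h
    have := congrArg Nat.primeFactors h
    simpa only [Nat.primeFactors_prod (hP s hs), Nat.primeFactors_prod (hP t ht)] using this
  · rintro n ⟨h0, hsq, h⟩
    refine ⟨n.primeFactors, ?_, Nat.prod_primeFactors_of_squarefree hsq⟩
    rw [Finset.mem_coe, Finset.mem_powerset]
    intro p hp
    exact (mem_smallPrimes y p).2 ⟨(Nat.mem_primeFactors.1 hp).1, (h p hp).2⟩

theorem tau_prod (t : Finset ℕ) (ht : ∀ p ∈ t, p.Prime) :
    tauN (∏ p ∈ t, p) = ∏ p ∈ t, 2 := by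
  induction t using Finset.induction_on with
  | empty => simp [tauN]
  | insert a s ha ih =>
    rw [Finset.prod_insert ha, Finset.prod_insert ha,
      ← ih fun p hp => ht p (Finset.mem_insert_of_mem hp)]
    have hap := ht a (Finset.mem_insert_self a s)
    unfold tauN
    rw [Nat.Coprime.card_divisors_mul]
    · congr 1
      rw [Nat.Prime.divisors hap, Finset.card_pair hap.one_lt.ne]
    · apply Nat.Coprime.prod_right
      intro b hb
      refine (Nat.coprime_primes hap (ht b (Finset.mem_insert_of_mem hb))).2 ?_
      rintro rfl
      exact ha hb

theorem tau_sum (y e : ℝ) :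
    ∑ᶠ n ∈ Sset 1 y, (tauN n : ℝ) * (n : ℝ) ^ e / n
      = ∏ p ∈ smallPrimes y, (1 + 2 * (p : ℝ) ^ e / p) := by
  rw [Finset.prod_one_add, ← finsum_mem_coe_finset]
  symm
  apply finsum_mem_eq_of_bijOn _ (Sset_bij y)
  intro t ht
  have hP : ∀ p ∈ t, p.Prime := fun p hp =>
    ((mem_smallPrimes y p).1 (Finset.mem_powerset.1 (Finset.mem_coe.1 ht) hp)).1
  rw [tau_prod t hP, Finset.prod_div_distrib, Finset.prod_mul_distrib, Nat.cast_prod, Nat.cast_prod,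
    Real.finsetProd_rpow _ _ (fun i _ => Nat.cast_nonneg i)]
  simp

theorem euler_le (y ε : ℝ) (hε : 0 < ε) :
    ∏ p ∈ smallPrimes y, (1 + (p : ℝ) ^ (-1 - ε)) ≤ 1 + 1 / ε := by
  rw [Finset.prod_one_add]
  have hP : ∀ t ∈ (smallPrimes y).powerset, ∀ p ∈ t, p.Prime := fun t ht p hp =>
    ((mem_smallPrimes y p).1 (Finset.mem_powerset.1 ht hp)).1
  have e1 : ∀ t ∈ (smallPrimes y).powerset,
      ∏ p ∈ t, (p : ℝ) ^ (-1 - ε) = ((∏ p ∈ t, p - 1 + 1 : ℕ) : ℝ) ^ (-1 - ε) := by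
    intro t ht
    have : 0 < ∏ p ∈ t, p := Finset.prod_pos fun p hp => (hP t ht p hp).pos
    rw [Real.finsetProd_rpow _ _ (fun i _ => Nat.cast_nonneg i), Nat.sub_add_cancel this,
      Nat.cast_prod]
  rw [Finset.sum_congr rfl e1]
  set g : Finset ℕ → ℕ := fun t => ∏ p ∈ t, p - 1 with hg
  have hinj : Set.InjOn g ((smallPrimes y).powerset : Set (Finset ℕ)) := by
    intro s hs t ht h
    apply (Sset_bij y).injOn hs ht
    have h1 : 0 < ∏ p ∈ s, p := Finset.prod_pos fun p hp => (hP s hs p hp).pos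
    have h2 : 0 < ∏ p ∈ t, p := Finset.prod_pos fun p hp => (hP t ht p hp).pos
    simp only [hg] at h ⊢
    omega
  have e2 : ∑ t ∈ (smallPrimes y).powerset, ((g t + 1 : ℕ) : ℝ) ^ (-1 - ε)
      = ∑ n ∈ (smallPrimes y).powerset.image g, ((n + 1 : ℕ) : ℝ) ^ (-1 - ε) :=
    (Finset.sum_image (f := fun n : ℕ => ((n + 1 : ℕ) : ℝ) ^ (-1 - ε)) hinj).symm
  change ∑ t ∈ (smallPrimes y).powerset, ((g t + 1 : ℕ) : ℝ) ^ (-1 - ε) ≤ _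
  rw [e2]
  set M := ((smallPrimes y).powerset.image g).sup id
  calc _ ≤ ∑ n ∈ Finset.range (M + 1), ((n + 1 : ℕ) : ℝ) ^ (-1 - ε) := by
        apply Finset.sum_le_sum_of_subset_of_nonneg
        · intro n hn
          rw [Finset.mem_range]
          exact Nat.lt_succ_of_le (Finset.le_sup (f := id) hn)
        · intro n _ _
          positivity
    _ ≤ _ := zeta_partial ε hε M
    _ ≤ _ := by
        have : 0 ≤ (1 / ε) * ((M + 1 : ℕ) : ℝ) ^ (-ε) := by positivity
        linarith

theorem primeProd_eq (y : ℝ) :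
    primeProd 1 y = ∏ p ∈ smallPrimes y, ((1 : ℝ) + 1 / p)⁻¹ := by
  unfold primeProd
  rw [← finprod_mem_coe_finset]
  congr 1
  ext p
  have : p ∈ {p : ℕ | p.Prime ∧ (1 : ℝ) ≤ (p : ℝ) ∧ (p : ℝ) < y} ↔
      p ∈ (smallPrimes y : Set ℕ) := by
    rw [Finset.mem_coe, mem_smallPrimes, Set.mem_setOf_eq]
    constructor
    · rintro ⟨h1, _, h2⟩
      exact ⟨h1, h2⟩
    · rintro ⟨h1, h2⟩
      exact ⟨h1, by exact_mod_cast h1.one_le, h2⟩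
  rw [finprod_congr_Prop (propext this) (fun _ => rfl)]

theorem factor_le (p ε : ℝ) (hp : 1 ≤ p) (hε : 0 ≤ ε) (h : ε * Real.log p ≤ 1) :
    (1 + 1 / p)⁻¹ * (1 + 2 * p ^ ε / p)
      ≤ (1 + p ^ (-1 - ε)) * Real.exp (5 * ε * (Real.log p / p)) := by
  have hp0 : 0 < p := by linarith
  set t := ε * Real.log p with ht
  have ht0 : 0 ≤ t := mul_nonneg hε (Real.log_nonneg hp)
  have e1 : p ^ ε = Real.exp t := by rw [Real.rpow_def_of_pos hp0, mul_comm]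
  have e2 : p ^ (-1 - ε) = Real.exp (-t) / p := by
    rw [show -1 - ε = -ε - 1 by ring, Real.rpow_sub_one hp0.ne', Real.rpow_def_of_pos hp0]
    congr 2
    rw [ht]; ring
  have h1 : Real.exp t ≤ 1 + 2 * t := by
    have hc := convexOn_exp.2 (Set.mem_univ 0) (Set.mem_univ 1)
      (by linarith : 0 ≤ 1 - t) ht0 (by ring)
    simp only [smul_eq_mul, Real.exp_zero, mul_zero, mul_one, zero_add] at hc
    nlinarith [Real.exp_one_lt_d9]
  have h2 : 1 - t ≤ Real.exp (-t) := by linarith [Real.add_one_le_exp (-t)]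
  have h3 : 0 < Real.exp (-t) := Real.exp_pos _
  have h4 : 5 * ε * (Real.log p / p) = 5 * t / p := by rw [ht]; ring
  have h5 := Real.add_one_le_exp (5 * t / p)
  rw [e1, e2, h4, inv_mul_le_iff₀ (by positivity)]
  have hc0 : 0 ≤ Real.exp (-t) / p := by positivity
  have hb0 : 0 ≤ 1 / p := by positivity
  have hd0 : 0 ≤ 5 * t / p := by positivity
  have h6 : 1 + 2 * Real.exp t / p ≤ 1 + 1 / p + Real.exp (-t) / p + 5 * t / p := by
    have : 2 * Real.exp t / p ≤ (1 + Real.exp (-t) + 5 * t) / p := by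
      gcongr
      linarith
    have h7 : (1 + Real.exp (-t) + 5 * t) / p = 1 / p + Real.exp (-t) / p + 5 * t / p := by ring
    linarith
  calc _ ≤ _ := h6
    _ ≤ (1 + 1 / p) * ((1 + Real.exp (-t) / p) * (5 * t / p + 1)) := by
        generalize 1 / p = b at *
        generalize Real.exp (-t) / p = c at *
        generalize 5 * t / p = d at *
        have := mul_nonneg hb0 hc0
        have := mul_nonneg hb0 hd0
        have := mul_nonneg hc0 hd0
        have := mul_nonneg (mul_nonneg hb0 hc0) hd0
        nlinarith
    _ ≤ _ := by gcongr

theorem statement17 :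
    ∃ C : ℝ, 0 < C ∧ ∀ y : ℝ, 2 ≤ y →
      primeProd 1 y * ∑ᶠ n ∈ Sset 1 y, (tauN n : ℝ) * (n : ℝ) ^ (1 / LLog y) / n
        ≤ C * LLog y := by
  refine ⟨2 * Real.exp (5 * (1 + Real.log 4)), by positivity, ?_⟩
  intro y hy
  have hL1 : 1 ≤ LLog y := le_max_left _ _
  have hLy : Real.log y ≤ LLog y := le_max_right _ _
  have hL0 : 0 < LLog y := by linarith
  rw [tau_sum, primeProd_eq, ← Finset.prod_mul_distrib]
  have hε : 0 < 1 / LLog y := by positivity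
  have hl4 : 0 ≤ Real.log 4 := Real.log_nonneg (by norm_num)
  have hN : 1 ≤ ⌊y⌋₊ := Nat.le_floor (by push_cast; linarith)
  have hm : ∑ p ∈ smallPrimes y, Real.log p / p ≤ LLog y + Real.log 4 := by
    calc _ ≤ ∑ p ∈ (Finset.Ioc 0 ⌊y⌋₊).filter Nat.Prime, Real.log p / p := by
          apply Finset.sum_le_sum_of_subset_of_nonneg
          · intro p hp
            rw [mem_smallPrimes] at hp
            rw [Finset.mem_filter, Finset.mem_Ioc]
            exact ⟨⟨hp.1.pos, Nat.le_floor hp.2.le⟩, hp.1⟩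
          · intro p _ _
            have := Real.log_natCast_nonneg p
            positivity
      _ ≤ _ := mertens_upper _ hN
      _ ≤ _ := by
          have : Real.log ⌊y⌋₊ ≤ Real.log y :=
            Real.log_le_log (by exact_mod_cast hN) (Nat.floor_le (by linarith))
          linarith
  calc _ ≤ ∏ p ∈ smallPrimes y, ((1 + (p : ℝ) ^ (-1 - 1 / LLog y)) *
        Real.exp (5 * (1 / LLog y) * (Real.log p / p))) := by
        apply Finset.prod_le_prod
        · intro p _
          positivity
        · intro p hp
          rw [mem_smallPrimes] at hp
          have hp1 : (1 : ℝ) ≤ p := by exact_mod_cast hp.1.one_le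
          refine factor_le p _ hp1 hε.le ?_
          rw [one_div, inv_mul_le_iff₀ hL0, mul_one]
          exact (Real.log_le_log (by linarith) hp.2.le).trans hLy
    _ = (∏ p ∈ smallPrimes y, (1 + (p : ℝ) ^ (-1 - 1 / LLog y))) *
        Real.exp (5 * (1 / LLog y) * ∑ p ∈ smallPrimes y, Real.log p / p) := by
        rw [Finset.prod_mul_distrib, ← Real.exp_sum, Finset.mul_sum]
    _ ≤ (1 + 1 / (1 / LLog y)) * Real.exp (5 * (1 + Real.log 4)) := by
        have h1 := euler_le y _ hε
        have h2 : 5 * (1 / LLog y) * ∑ p ∈ smallPrimes y, Real.log p / p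
            ≤ 5 * (1 + Real.log 4) := by
          have : 1 / LLog y * ∑ p ∈ smallPrimes y, Real.log p / p ≤ 1 + Real.log 4 := by
            rw [one_div, inv_mul_le_iff₀ hL0]
            nlinarith
          linarith
        gcongr
    _ ≤ _ := by
        rw [one_div_one_div]
        have := Real.exp_pos (5 * (1 + Real.log 4))
        nlinarith
end

section
/- There exists y₀ such that for all y ≥ y₀ the following holds: if a ≥ 3 is an integer with a ≤ exp((log y)^{1/3}) and λ > 1 is a real number with λ^{a−2} ≥ y, then 1 − ∏_{λ^{a−2} ≤ p < λ^{a−1}} p/(p+1) ≥ 1/a, where the product is over primes p. -/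
open Filter Topology
open scoped Classical

open Metric in
theorem aux_log_deriv {g : ℂ → ℂ} {R A : ℝ} {z : ℂ} (hA : 0 < A)
    (hg : DifferentiableOn ℂ g (ball 0 R)) (hne : ∀ w ∈ ball (0:ℂ) R, g w ≠ 0)
    (hb : ∀ w ∈ ball (0:ℂ) R, ‖g w‖ ≤ Real.exp A * ‖g 0‖) (hz : z ∈ ball (0:ℂ) R) :
    ‖deriv g z / g z‖ ≤ 8 * A * R / (R - ‖z‖) ^ 2 := by
  have hz' : ‖z‖ < R := by simpa using hz
  have hR : 0 < R := lt_of_le_of_lt (norm_nonneg z) hz'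
  have hd : DifferentiableOn ℂ (deriv g) (ball 0 R) := hg.deriv isOpen_ball
  obtain ⟨h, hh⟩ := (hd.div hg hne).isExactOn_ball
  have h0 : (0:ℂ) ∈ ball (0:ℂ) R := by simpa using hR
  -- normalise
  have key : ∀ w ∈ ball (0:ℂ) R, g w = g 0 * Complex.exp (h w - h 0) := by
    intro w hw
    have hconst : ∀ x ∈ ball (0:ℂ) R, HasDerivAt (fun x => g x * Complex.exp (-(h x - h 0))) 0 x := by
      intro x hx
      have h1 : HasDerivAt g (deriv g x) x :=
        (hg.differentiableAt (isOpen_ball.mem_nhds hx)).hasDerivAt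
      have h2 := hh x hx
      have h3 := h1.mul (((h2.sub_const (h 0)).neg).cexp)
      refine h3.congr_deriv ?_
      have := hne x hx
      simp only [Pi.div_apply, Pi.neg_apply]
      field_simp
      ring
    have := (convex_ball (0:ℂ) R).is_const_of_fderivWithin_eq_zero (𝕜 := ℂ)
      (f := fun x => g x * Complex.exp (-(h x - h 0)))
      (fun x hx => (hconst x hx).differentiableAt.differentiableWithinAt)
      (fun x hx => by
        rw [fderivWithin_of_isOpen isOpen_ball hx]
        have := (hconst x hx).hasFDerivAt.fderiv
        simpa using this) hw h0
    simp only [sub_self, neg_zero, Complex.exp_zero, mul_one] at this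
    rw [← this, mul_assoc, ← Complex.exp_add]
    simp
  have hg0 := hne 0 h0
  have hre : Set.MapsTo (fun w => h w - h 0) (ball 0 R) {z | z.re ≤ A} := by
    intro w hw
    have h1 := hb w hw
    rw [key w hw, norm_mul, Complex.norm_exp, mul_comm] at h1
    have h2 := le_of_mul_le_mul_right h1 (norm_pos_iff.mpr hg0)
    simpa using h2
  have hdiff : DifferentiableOn ℂ (fun w => h w - h 0) (ball 0 R) := fun x hx =>
    ((hh x hx).sub_const (h 0)).differentiableAt.differentiableWithinAt
  set r := (R - ‖z‖) / 2 with hr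
  have hrpos : 0 < r := by rw [hr]; linarith
  have hbound : ∀ w ∈ sphere z r, ‖h w - h 0‖ ≤ 2 * A * R / r := by
    intro w hw
    have hw1 : ‖w‖ ≤ R - r := by
      have : ‖w - z‖ = r := by simpa [dist_eq_norm] using hw
      have h3 : ‖w‖ ≤ ‖w - z‖ + ‖z‖ := by simpa using norm_add_le (w - z) z
      rw [this] at h3
      linarith
    have hw2 : w ∈ ball (0:ℂ) R := by simp; linarith
    have := Complex.borelCaratheodory_zero hA hdiff hre hR hw2 (by simp)
    refine this.trans ?_
    gcongr
    · linarith
    · linarith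
  have hball : closedBall z r ⊆ ball (0:ℂ) R := by
    intro w hw
    have : ‖w - z‖ ≤ r := by simpa [dist_eq_norm] using hw
    have h3 : ‖w‖ ≤ ‖w - z‖ + ‖z‖ := by simpa using norm_add_le (w - z) z
    simp; linarith
  have hdc : DiffContOnCl ℂ (fun w => h w - h 0) (ball z r) := by
    apply DifferentiableOn.diffContOnCl
    rw [closure_ball z hrpos.ne']
    exact hdiff.mono hball
  have := Complex.norm_deriv_le_of_forall_mem_sphere_norm_le hrpos hdc hbound
  rw [((hh z hz).sub_const (h 0)).deriv] at this
  simp only [Pi.div_apply] at this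
  refine this.trans (le_of_eq ?_)
  have : R - ‖z‖ ≠ 0 := by linarith
  rw [hr]; field_simp; ring

open Metric ComplexConjugate in
/-- peel off one zero by a Blaschke factor -/
theorem aux_peel {f : ℂ → ℂ} {R M : ℝ} {ρ : ℂ} (hR : 0 < R) (hf : Differentiable ℂ f)
    (hM : ∀ w ∈ sphere (0:ℂ) R, ‖f w‖ ≤ M) (hf0 : f 0 ≠ 0) (hρ : f ρ = 0) (hρR : ‖ρ‖ ≤ R / 2) :
    ∃ g : ℂ → ℂ, Differentiable ℂ g ∧ (∀ w ∈ sphere (0:ℂ) R, ‖g w‖ ≤ M) ∧ 2 * ‖f 0‖ ≤ ‖g 0‖ ∧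
      (∀ w ∈ ball (0:ℂ) R, g w = 0 → f w = 0) ∧
      deriv f 0 / f 0 = deriv g 0 / g 0 + (- 1 / ρ + conj ρ / R ^ 2) := by
  have hρ0 : ρ ≠ 0 := by rintro rfl; exact hf0 hρ
  set q : ℂ → ℂ := dslope f ρ with hq
  have hqd : Differentiable ℂ q := by
    rw [← differentiableOn_univ] at hf ⊢
    exact (Complex.differentiableOn_dslope univ_mem).mpr hf
  have hfq : ∀ w, f w = (w - ρ) * q w := by
    intro w
    have := sub_smul_dslope f ρ w
    rw [hρ, sub_zero] at this
    simpa using this.symm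
  have hRc : (R:ℂ) ≠ 0 := by exact_mod_cast hR.ne'
  have hq0 : q 0 ≠ 0 := by
    intro h; apply hf0; rw [hfq, h, mul_zero]
  refine ⟨fun w => q w * ((R ^ 2 - conj ρ * w) / R), by fun_prop, ?_, ?_, ?_, ?_⟩
  · intro w hw
    have hw' : ‖w‖ = R := by simpa using hw
    refine le_trans (le_of_eq ?_) (hM w hw)
    rw [hfq, norm_mul, norm_mul, mul_comm]
    congr 1
    have h1 : (R:ℂ)^2 = conj w * w := by
      rw [← Complex.normSq_eq_conj_mul_self, Complex.normSq_eq_norm_sq, hw']; push_cast; rfl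
    rw [h1, ← sub_mul, ← map_sub, norm_div, norm_mul, hw', Complex.norm_conj, Complex.norm_real,
      Real.norm_of_nonneg hR.le]
    field_simp
  · rw [hfq]
    simp only [mul_zero, sub_zero, zero_sub, norm_mul, norm_neg, norm_div, norm_pow,
      Complex.norm_real, Real.norm_of_nonneg hR.le]
    have : R ^ 2 / R = R := by field_simp
    rw [this]
    nlinarith [norm_nonneg (q 0)]
  · intro w hw h
    have hw' : ‖w‖ < R := by simpa using hw
    rcases mul_eq_zero.mp h with h | h
    · rw [hfq, h, mul_zero]
    · exfalso
      rw [div_eq_zero_iff, or_iff_left hRc, sub_eq_zero] at h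
      have := congrArg norm h
      rw [norm_mul, Complex.norm_conj, norm_pow, Complex.norm_real, Real.norm_of_nonneg hR.le] at this
      nlinarith [norm_nonneg w, norm_nonneg ρ]
  · have h1 : deriv f 0 = q 0 + (0 - ρ) * deriv q 0 := by
      have : f = fun w => (w - ρ) * q w := funext hfq
      rw [this]
      have h2 : HasDerivAt (fun w : ℂ => (w - ρ) * q w) (1 * q 0 + (0 - ρ) * deriv q 0) 0 :=
        ((hasDerivAt_id (0:ℂ)).sub_const ρ).mul (hqd 0).hasDerivAt
      rw [h2.deriv, one_mul]
    have h3 : deriv (fun w => q w * ((R ^ 2 - conj ρ * w) / R)) 0 =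
        deriv q 0 * R - q 0 * conj ρ / R := by
      have h2 : HasDerivAt (fun w : ℂ => q w * ((R ^ 2 - conj ρ * w) / R))
        (deriv q 0 * ((R ^ 2 - conj ρ * 0) / R) + q 0 * ((-(conj ρ * 1)) / R)) 0 :=
        (hqd 0).hasDerivAt.mul ((((hasDerivAt_id (0:ℂ)).const_mul (conj ρ)).const_sub _).div_const _)
      rw [h2.deriv]
      field_simp
      ring
    rw [h1, h3, hfq 0]
    field_simp
    ring

open Metric ComplexConjugate in
theorem aux_re_nonneg {R : ℝ} {ρ : ℂ} (hρR : ‖ρ‖ ≤ R) (hre : ρ.re ≤ 0) :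
    0 ≤ (- 1 / ρ + conj ρ / R ^ 2).re := by
  by_cases h0 : ρ = 0
  · simp [h0]
  have h1 : (- 1 / ρ + conj ρ / R ^ 2).re = ρ.re * (1 / R ^ 2 - 1 / ‖ρ‖^2) := by
    rw [← Complex.ofReal_pow, Complex.add_re, Complex.div_ofReal_re, neg_div, one_div, Complex.neg_re,
      Complex.inv_re, Complex.normSq_eq_norm_sq]
    simp; ring
  rw [h1]
  have h2 : 0 < ‖ρ‖ := norm_pos_iff.mpr h0
  have : 1 / R ^ 2 ≤ 1 / ‖ρ‖^2 := by gcongr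
  nlinarith

open Metric in
theorem aux_max {g : ℂ → ℂ} {R C : ℝ} (hR : 0 < R) (hg : Differentiable ℂ g)
    (hC : ∀ w ∈ sphere (0:ℂ) R, ‖g w‖ ≤ C) : ∀ w ∈ closedBall (0:ℂ) R, ‖g w‖ ≤ C := by
  intro w hw
  refine Complex.norm_le_of_forall_mem_frontier_norm_le (U := ball (0:ℂ) R) isBounded_ball
    hg.diffContOnCl ?_ ?_
  · rw [frontier_ball _ hR.ne']; exact hC
  · rwa [closure_ball _ hR.ne']

open Metric ComplexConjugate in
theorem aux_landau_ind (N : ℕ) : ∀ {f : ℂ → ℂ} {R A M : ℝ}, 0 < R → 0 < A → Differentiable ℂ f →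
    f 0 ≠ 0 → (∀ w ∈ sphere (0:ℂ) R, ‖f w‖ ≤ M) → M ≤ Real.exp A * ‖f 0‖ →
    (∀ w ∈ ball (0:ℂ) (R/2), f w = 0 → w.re ≤ 0) → M < 2 ^ N * ‖f 0‖ →
    - (16 * A / R) ≤ (deriv f 0 / f 0).re := by
  induction N with
  | zero =>
    intro f R A M hR hA hf hf0 hM hMA hz hN
    have := aux_max hR hf hM 0 (by simp [hR.le])
    simp at hN
    linarith
  | succ N ih =>
    intro f R A M hR hA hf hf0 hM hMA hz hN
    by_cases hex : ∃ ρ ∈ ball (0:ℂ) (R/2), f ρ = 0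
    · obtain ⟨ρ, hρ, hfρ⟩ := hex
      have hρ' : ‖ρ‖ < R / 2 := by simpa using hρ
      obtain ⟨g, hg, hgM, hg0, hgz, hgd⟩ := aux_peel hR hf hM hf0 hfρ hρ'.le
      have hf0' : 0 < ‖f 0‖ := norm_pos_iff.mpr hf0
      have hre := aux_re_nonneg (by linarith : ‖ρ‖ ≤ R) (hz ρ hρ hfρ)
      have hgpos : 0 < ‖g 0‖ := by linarith
      rw [hgd, Complex.add_re]
      have h := ih (f := g) hR hA hg (norm_pos_iff.mp hgpos) hgM
        (hMA.trans (by gcongr; linarith)) (fun w hw h0 => hz w hw (hgz w (by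
          have : ‖w‖ < R/2 := by simpa using hw
          simp; linarith) h0)) (by
          have h2 : (0:ℝ) < 2 ^ N := by positivity
          rw [pow_succ] at hN
          nlinarith)
      linarith
    · push Not at hex
      have := aux_log_deriv (g := f) (R := R/2) (z := 0) hA hf.differentiableOn
        (fun w hw => hex w hw) (fun w hw => (aux_max hR hf hM w (by
          have : ‖w‖ < R/2 := by simpa using hw
          simp; linarith)).trans hMA) (by simp [hR])
      have h2 := Complex.abs_re_le_norm (deriv f 0 / f 0)
      have h3 := (abs_le.mp (h2.trans this)).1
      refine le_trans (le_of_eq ?_) h3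
      simp
      field_simp
      ring

open Metric in
theorem aux_landau {f : ℂ → ℂ} {R A : ℝ} (hR : 0 < R) (hA : 0 < A) (hf : Differentiable ℂ f)
    (hf0 : f 0 ≠ 0) (hM : ∀ w ∈ sphere (0:ℂ) R, ‖f w‖ ≤ Real.exp A * ‖f 0‖)
    (hz : ∀ w ∈ ball (0:ℂ) (R/2), f w = 0 → w.re ≤ 0) :
    - (16 * A / R) ≤ (deriv f 0 / f 0).re := by
  obtain ⟨N, hN⟩ := pow_unbounded_of_one_lt (Real.exp A) (one_lt_two : (1:ℝ) < 2)
  exact aux_landau_ind N hR hA hf hf0 hM le_rfl hz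
    (by have := norm_pos_iff.mpr hf0; gcongr)

open Metric in
theorem aux_landau_zero {f : ℂ → ℂ} {R A d : ℝ} (hR : 0 < R) (hA : 0 < A) (hf : Differentiable ℂ f)
    (hf0 : f 0 ≠ 0) (hM : ∀ w ∈ sphere (0:ℂ) R, ‖f w‖ ≤ Real.exp A * ‖f 0‖)
    (hz : ∀ w ∈ ball (0:ℂ) (R/2), f w = 0 → w.re ≤ 0)
    (hd : 0 < d) (hdR : d ≤ R / 2) (hfd : f (-d) = 0) :
    1 / d - d / R ^ 2 - (16 * A / R) ≤ (deriv f 0 / f 0).re := by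
  have hf0' : 0 < ‖f 0‖ := norm_pos_iff.mpr hf0
  obtain ⟨g, hg, hgM, hg0, hgz, hgd⟩ := aux_peel hR hf hM hf0 hfd
    (by simpa [abs_of_pos hd] using hdR)
  have hgpos : 0 < ‖g 0‖ := by linarith
  have := aux_landau hR hA hg (norm_pos_iff.mp hgpos)
    (fun w hw => (hgM w hw).trans (by gcongr; linarith)) (fun w hw h0 => hz w hw (hgz w (by
          have : ‖w‖ < R/2 := by simpa using hw
          simp; linarith) h0))
  rw [hgd, Complex.add_re]
  have h2 : (-1 / -(d:ℂ) + (starRingEnd ℂ) (-(d:ℂ)) / R ^ 2).re = 1 / d - d / R ^ 2 := by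
    rw [map_neg, Complex.conj_ofReal]
    have : (-1 / -(d:ℂ) + (-(d:ℂ)) / R ^ 2) = ((1 / d - d / R ^ 2 : ℝ) : ℂ) := by
      push_cast; rw [neg_div_neg_eq]; ring
    rw [this, Complex.ofReal_re]
  rw [h2]
  linarith

/-- `(s-1) ζ(s)` -/
noncomputable abbrev ZZ (s : ℂ) : ℂ := riemannZeta₁ s

theorem ZZ_eq {s : ℂ} (hs : s ≠ 1) : ZZ s = (s - 1) * riemannZeta s := by
  rw [riemannZeta_eq_inv_sub_mul hs]
  have : s - 1 ≠ 0 := sub_ne_zero.mpr hs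
  field_simp

theorem ZZ_diff : Differentiable ℂ ZZ := differentiable_riemannZeta₁

theorem ZZ_ne_zero {s : ℂ} (hs : 1 ≤ s.re) : ZZ s ≠ 0 := by
  by_cases h : s = 1
  · simp [ZZ, h]
  · rw [ZZ_eq h]
    exact mul_ne_zero (sub_ne_zero.mpr h) (riemannZeta_ne_zero_of_one_le_re hs)

noncomputable def fracF (t : ℝ) : ℂ := Set.indicator (Set.Ioi (1:ℝ)) (fun t => ((Int.fract t : ℝ) : ℂ)) t

theorem fracF_norm (t : ℝ) : ‖fracF t‖ ≤ 1 := by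
  unfold fracF
  rw [Set.indicator_apply]
  split_ifs
  · rw [Complex.norm_real, Real.norm_of_nonneg (Int.fract_nonneg t)]
    exact (Int.fract_lt_one t).le
  · simp

theorem fracF_meas : Measurable fracF := by
  unfold fracF
  exact (Complex.measurable_ofReal.comp measurable_fract).indicator measurableSet_Ioi

theorem fracF_mellin_diff {s : ℂ} (hs : s.re < 0) : DifferentiableAt ℂ (mellin fracF) s := by
  have hloc : MeasureTheory.LocallyIntegrable fracF := by
    refine (MeasureTheory.locallyIntegrable_const (1:ℝ)).mono fracF_meas.aestronglyMeasurable ?_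
    filter_upwards with t
    simpa using fracF_norm t
  refine mellin_differentiableAt_of_isBigO_rpow (a := 0) (b := s.re - 1) 
    (hloc.locallyIntegrableOn _) ?_ hs ?_ (by linarith)
  · refine Asymptotics.IsBigO.of_bound 1 ?_
    filter_upwards with t
    simpa using fracF_norm t
  · refine Asymptotics.IsBigO.of_bound 1 ?_
    have : Set.Ioo (0:ℝ) 1 ∈ 𝓝[>] (0:ℝ) := Ioo_mem_nhdsGT one_pos
    filter_upwards [this] with t ht
    have : fracF t = 0 := by
      unfold fracF
      rw [Set.indicator_of_notMem]
      simp [ht.2.le]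
    rw [this]; simp

theorem fracF_mellin_eq (s : ℂ) : mellin fracF (-s) =
    ∫ t in Set.Ioi (1:ℝ), (t:ℂ) ^ (-(s+1)) * ((Int.fract t : ℝ) : ℂ) := by
  unfold mellin fracF
  have : ∀ t : ℝ, ((t:ℂ) ^ (-s - 1)) • (Set.Ioi (1:ℝ)).indicator (fun t => ((Int.fract t : ℝ) : ℂ)) t
     = (Set.Ioi (1:ℝ)).indicator (fun t : ℝ => (t:ℂ) ^ (-(s+1)) * ((Int.fract t : ℝ) : ℂ)) t := by
    intro t
    by_cases h : t ∈ Set.Ioi (1:ℝ)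
    · rw [Set.indicator_of_mem h, Set.indicator_of_mem h, smul_eq_mul]; congr 2; ring
    · rw [Set.indicator_of_notMem h, Set.indicator_of_notMem h, smul_zero]
  simp_rw [this]
  rw [MeasureTheory.setIntegral_indicator measurableSet_Ioi]
  congr 2
  ext x; simp
  try (intro h; linarith)

theorem fracF_mellin_bound {s : ℂ} (hs : 1/2 ≤ s.re) : ‖mellin fracF (-s)‖ ≤ 2 := by
  rw [fracF_mellin_eq]
  have h1 : ∀ t ∈ Set.Ioi (1:ℝ), ‖(t:ℂ) ^ (-(s+1)) * ((Int.fract t : ℝ) : ℂ)‖ ≤ t ^ (-(3/2) : ℝ) := by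
    intro t ht
    have ht' : 1 < t := ht
    rw [norm_mul, Complex.norm_cpow_eq_rpow_re_of_pos (by linarith), Complex.norm_real,
      Real.norm_of_nonneg (Int.fract_nonneg t)]
    calc t ^ (-(s+1)).re * Int.fract t ≤ t ^ (-(s+1)).re * 1 := by
          gcongr
          exact (Int.fract_lt_one t).le
      _ ≤ t ^ (-(3/2) : ℝ) := by
          rw [mul_one]
          apply Real.rpow_le_rpow_of_exponent_le ht'.le
          simp; linarith
  refine (MeasureTheory.norm_integral_le_of_norm_le (integrableOn_Ioi_rpow_of_lt (by norm_num) one_pos) 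
    ((MeasureTheory.ae_restrict_iff' measurableSet_Ioi).mpr (Filter.Eventually.of_forall h1))).trans ?_
  rw [integral_Ioi_rpow_of_lt (by norm_num) one_pos]
  norm_num

theorem ZZ_formula_right {s : ℂ} (hs : 1 < s.re) :
    ZZ s = s - s * (s - 1) * mellin fracF (-s) := by
  have hs1 : s ≠ 1 := by rintro rfl; simp at hs
  have hs0 : s - 1 ≠ 0 := sub_ne_zero.mpr hs1
  rw [ZZ_eq hs1, ← LSeries_one_eq_riemannZeta hs, fracF_mellin_eq]
  have hO : (fun n : ℕ ↦ ∑ k ∈ Finset.Icc 1 n, (1 : ℕ → ℂ) k) =O[atTop] fun n ↦ (n : ℝ) ^ (1:ℝ) := by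
    refine Asymptotics.IsBigO.of_bound 1 ?_
    filter_upwards with n
    simp
  rw [LSeries_eq_mul_integral (1 : ℕ → ℂ) zero_le_one hs (LSeriesSummable_one_iff.mpr hs) hO]
  have hint1 : MeasureTheory.IntegrableOn (fun t : ℝ => (t:ℂ) ^ (-s)) (Set.Ioi 1) :=
    integrableOn_Ioi_cpow_of_lt (by simpa using hs) one_pos
  have hint2 : MeasureTheory.IntegrableOn
      (fun t : ℝ => (t:ℂ) ^ (-(s+1)) * ((Int.fract t : ℝ) : ℂ)) (Set.Ioi 1) := by
    refine (integrableOn_Ioi_cpow_of_lt (a := -(s+1)) (by simp; linarith) one_pos).mul_bdd (c := 1)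
      (Complex.measurable_ofReal.comp measurable_fract).aestronglyMeasurable ?_
    filter_upwards with t
    change ‖((Int.fract t : ℝ) : ℂ)‖ ≤ 1
    rw [Complex.norm_real, Real.norm_of_nonneg (Int.fract_nonneg t)]
    exact (Int.fract_lt_one t).le
  have : ∫ t in Set.Ioi (1 : ℝ), (∑ k ∈ Finset.Icc 1 ⌊t⌋₊, (1 : ℕ → ℂ) k) * (t:ℂ) ^ (-(s + 1))
     = ∫ t in Set.Ioi (1 : ℝ), ((t:ℂ) ^ (-s) - (t:ℂ) ^ (-(s+1)) * ((Int.fract t : ℝ) : ℂ)) := by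
    refine MeasureTheory.setIntegral_congr_fun measurableSet_Ioi ?_
    intro t ht
    have ht' : 1 < t := ht
    have ht0 : (t:ℂ) ≠ 0 := by exact_mod_cast (by linarith : t ≠ 0)
    have hfl : ((⌊t⌋₊ : ℕ) : ℂ) = (t:ℂ) - ((Int.fract t : ℝ) : ℂ) := by
      have h1 : ((⌊t⌋₊ : ℕ) : ℝ) = t - Int.fract t := by
        rw [Int.self_sub_fract, natCast_floor_eq_intCast_floor (by linarith)]
      rw [← Complex.ofReal_natCast, h1]; push_cast; rfl
    simp only [Pi.one_apply, Finset.sum_const, Nat.card_Icc, add_tsub_cancel_right, nsmul_eq_mul, mul_one]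
    rw [hfl, sub_mul, mul_comm ((Int.fract t : ℝ) : ℂ)]
    congr 1
    rw [show -s = 1 + -(s+1) by ring, Complex.cpow_add _ _ ht0, Complex.cpow_one]
  rw [this, MeasureTheory.integral_sub hint1 hint2, integral_Ioi_cpow_of_lt (by simpa using hs) one_pos]
  simp only [Complex.ofReal_one, Complex.one_cpow]
  have : -s + 1 ≠ 0 := by intro h; apply hs0; linear_combination -h
  field_simp
  ring

theorem ZZ_formula {s : ℂ} (hs : 0 < s.re) :
    ZZ s = s - s * (s - 1) * mellin fracF (-s) := by
  have hopen : IsOpen {s : ℂ | 0 < s.re} := isOpen_lt continuous_const Complex.continuous_re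
  have h1 : AnalyticOnNhd ℂ ZZ {s : ℂ | 0 < s.re} :=
    ZZ_diff.differentiableOn.analyticOnNhd hopen
  have h2 : AnalyticOnNhd ℂ (fun s => s - s * (s - 1) * mellin fracF (-s)) {s : ℂ | 0 < s.re} := by
    apply DifferentiableOn.analyticOnNhd _ hopen
    intro z hz
    have hz' : 0 < z.re := hz
    have h3 : DifferentiableAt ℂ (fun s => mellin fracF (-s)) z :=
      DifferentiableAt.comp (g := mellin fracF) z (fracF_mellin_diff (by simpa using hz')) (by fun_prop)
    exact (by fun_prop : DifferentiableAt ℂ (fun s => s - s * (s - 1) * mellin fracF (-s)) z).differentiableWithinAt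
  have hconv : IsPreconnected {s : ℂ | 0 < s.re} := (convex_halfSpace_re_gt 0).isPreconnected
  refine h1.eqOn_of_preconnected_of_eventuallyEq h2 hconv (z₀ := 2) (by simp) ?_ hs
  have : {s : ℂ | 1 < s.re} ∈ 𝓝 (2:ℂ) :=
    (isOpen_lt continuous_const Complex.continuous_re).mem_nhds (by simp)
  filter_upwards [this] with z hz using ZZ_formula_right hz

theorem ZZ_bound {s : ℂ} (hs : 1/2 ≤ s.re) : ‖ZZ s‖ ≤ 3 * (‖s‖ + 1) ^ 2 := by
  rw [ZZ_formula (by linarith)]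
  have h1 := fracF_mellin_bound hs
  have h2 : ‖s - 1‖ ≤ ‖s‖ + 1 := by simpa using norm_sub_le s 1
  calc ‖s - s * (s-1) * mellin fracF (-s)‖ ≤ ‖s‖ + ‖s * (s-1) * mellin fracF (-s)‖ := norm_sub_le _ _
    _ = ‖s‖ + ‖s‖ * ‖s-1‖ * ‖mellin fracF (-s)‖ := by rw [norm_mul, norm_mul]
    _ ≤ ‖s‖ + ‖s‖ * (‖s‖ + 1) * 2 := by gcongr
    _ ≤ _ := by nlinarith [norm_nonneg s]

theorem zeta_real_bound {σ : ℝ} (h0 : 0 < σ) (h1 : σ ≤ 2) : ‖riemannZeta (1 + σ)‖ ≤ 48 / σ := by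
  have hne : (1 + σ : ℂ) ≠ 1 := by simpa using h0.ne'
  have h2 := ZZ_bound (s := 1 + σ) (by simp; linarith)
  rw [ZZ_eq hne, norm_mul] at h2
  have h3 : ‖(1 + σ : ℂ) - 1‖ = σ := by simp [abs_of_pos h0]
  have h4 : ‖(1 + σ : ℂ)‖ = 1 + σ := by
    rw [← Complex.ofReal_one, ← Complex.ofReal_add, Complex.norm_real, Real.norm_of_nonneg (by linarith)]
  rw [h3, h4] at h2
  rw [le_div_iff₀ h0]
  nlinarith

theorem zeta_lower {s : ℂ} (h0 : 1 < s.re) (h1 : s.re ≤ 3) : (s.re - 1) / 48 ≤ ‖riemannZeta s‖ := by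
  have hz := LSeries_one_mul_Lseries_moebius h0
  rw [LSeries_one_eq_riemannZeta h0] at hz
  have hb : ‖LSeries (fun n => ((ArithmeticFunction.moebius n : ℤ) : ℂ)) s‖ ≤ 48 / (s.re - 1) := by
    have h3 : LSeriesSummable (1 : ℕ → ℂ) (s.re : ℂ) := LSeriesSummable_one_iff.mpr (by simpa using h0)
    have h4 := zeta_real_bound (σ := s.re - 1) (by linarith) (by linarith)
    refine le_trans ?_ h4
    have h5 : (1 + ((s.re - 1 : ℝ) : ℂ)) = (s.re : ℂ) := by push_cast; ring
    have hnn : ∀ n, LSeries.term (1 : ℕ → ℂ) (s.re:ℂ) n = ((‖LSeries.term (1 : ℕ → ℂ) (s.re : ℂ) n‖ : ℝ) : ℂ) := by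
      intro n
      rcases Nat.eq_zero_or_pos n with rfl | hn
      · simp
      · rw [LSeries.term_of_ne_zero hn.ne', norm_div, Complex.norm_natCast_cpow_of_pos hn]
        simp only [Pi.one_apply, norm_one, Complex.ofReal_re]
        push_cast
        rw [Complex.ofReal_cpow (by positivity)]
        simp
    have h6 : ‖riemannZeta (s.re : ℂ)‖ = ∑' n, ‖LSeries.term (1 : ℕ → ℂ) (s.re : ℂ) n‖ := by
      rw [← LSeries_one_eq_riemannZeta (by simpa using h0), LSeries, tsum_congr hnn, ← Complex.ofReal_tsum,
        Complex.norm_real, Real.norm_of_nonneg (tsum_nonneg fun _ => norm_nonneg _)]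
    rw [h5, h6]
    have hle : ∀ n, ‖LSeries.term (fun n => ((ArithmeticFunction.moebius n : ℤ) : ℂ)) s n‖ ≤ ‖LSeries.term (1 : ℕ → ℂ) (s.re : ℂ) n‖ := by
      intro n
      rw [LSeries.norm_term_eq, LSeries.norm_term_eq]
      split_ifs
      · rfl
      · simp only [Complex.ofReal_re, Pi.one_apply, norm_one]
        gcongr
        rw [← Complex.ofReal_intCast, Complex.norm_real, Real.norm_eq_abs, ← Int.cast_abs]
        exact_mod_cast ArithmeticFunction.abs_moebius_le_one
    exact tsum_of_norm_bounded h3.norm.hasSum hle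
  have hn := congrArg norm hz
  rw [norm_mul, norm_one] at hn
  have hpos : 0 < s.re - 1 := by linarith
  rw [le_div_iff₀ hpos] at hb
  have := norm_nonneg (riemannZeta s)
  rw [div_le_iff₀ (by norm_num)]
  nlinarith

theorem ZZ_lower {s : ℂ} (h0 : 1 < s.re) (h1 : s.re ≤ 3) : (s.re - 1) ^ 2 / 48 ≤ ‖ZZ s‖ := by
  have hne : s ≠ 1 := by rintro rfl; simp at h0
  rw [ZZ_eq hne, norm_mul]
  have := zeta_lower h0 h1
  have h2 : s.re - 1 ≤ ‖s - 1‖ := by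
    have := Complex.re_le_norm (s - 1)
    simpa using this
  calc (s.re - 1) ^ 2 / 48 = (s.re - 1) * ((s.re - 1) / 48) := by ring
    _ ≤ _ := by gcongr

theorem ZZ_logderiv {s : ℂ} (hs : s ≠ 1) (hz : riemannZeta s ≠ 0) :
    deriv riemannZeta s / riemannZeta s = deriv ZZ s / ZZ s - 1 / (s - 1) := by
  have hs0 : s - 1 ≠ 0 := sub_ne_zero.mpr hs
  have h1 : HasDerivAt (fun z => (z - 1) * riemannZeta z)
      (1 * riemannZeta s + (s - 1) * deriv riemannZeta s) s :=
    ((hasDerivAt_id s).sub_const 1).mul (differentiableAt_riemannZeta hs).hasDerivAt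
  have h2 : deriv ZZ s = 1 * riemannZeta s + (s - 1) * deriv riemannZeta s := by
    rw [← h1.deriv]
    apply Filter.EventuallyEq.deriv_eq
    filter_upwards [isOpen_ne.mem_nhds hs] with z hz using ZZ_eq hz
  rw [h2, ZZ_eq hs]
  field_simp
  ring

open ArithmeticFunction in
theorem vm_341 {σ : ℝ} (hσ : 0 < σ) (γ : ℝ) :
    0 ≤ 3 * (LSeries (fun n => ((vonMangoldt n : ℝ) : ℂ)) (1 + σ)).re
      + 4 * (LSeries (fun n => ((vonMangoldt n : ℝ) : ℂ)) (1 + σ + γ * Complex.I)).re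
      + (LSeries (fun n => ((vonMangoldt n : ℝ) : ℂ)) (1 + σ + (2 * γ : ℝ) * Complex.I)).re := by
  have hs : ∀ t : ℝ, HasSum (fun n : ℕ => (vonMangoldt n : ℝ) * (n : ℝ) ^ (-(1+σ)) * Real.cos (t * Real.log n))
      (LSeries (fun n => ((vonMangoldt n : ℝ) : ℂ)) (1 + σ + t * Complex.I)).re := by
    intro t
    have h1 : LSeriesSummable (fun n => ((vonMangoldt n : ℝ) : ℂ)) (1 + σ + t * Complex.I) :=
      LSeriesSummable_vonMangoldt (by simp [hσ])
    have h2 : HasSum _ (LSeries (fun n => ((vonMangoldt n : ℝ) : ℂ)) (1 + σ + t * Complex.I)).re :=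
      Complex.hasSum_re h1.hasSum
    convert h2 using 1
    funext n
    rcases Nat.eq_zero_or_pos n with rfl | hn
    · simp
    rw [LSeries.term_of_ne_zero hn.ne']
    have hn0 : (n : ℂ) ≠ 0 := by exact_mod_cast hn.ne'
    have hnr : (0:ℝ) < n := by exact_mod_cast hn
    rw [div_eq_mul_inv, ← Complex.cpow_neg, Complex.re_ofReal_mul, mul_assoc]
    congr 1
    rw [Complex.cpow_def_of_ne_zero hn0, ← Complex.ofReal_natCast, ← Complex.ofReal_log hnr.le,
      Complex.exp_re]
    simp only [Complex.mul_re, Complex.mul_im, Complex.neg_re, Complex.neg_im, Complex.add_re,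
      Complex.add_im, Complex.ofReal_re, Complex.ofReal_im, Complex.one_re, Complex.one_im,
      Complex.I_re, Complex.I_im]
    rw [Real.rpow_def_of_pos hnr, ← Real.cos_neg (t * Real.log n)]
    congr 2 <;> ring
  have h0 := hs 0
  simp only [Complex.ofReal_zero, zero_mul, add_zero] at h0
  have hall := ((h0.mul_left 3).add ((hs γ).mul_left 4)).add (hs (2 * γ))
  refine hall.nonneg fun n => ?_
  have hΛ : 0 ≤ (vonMangoldt n : ℝ) * (n : ℝ) ^ (-(1+σ)) :=
    mul_nonneg vonMangoldt_nonneg (by positivity)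
  have hc : Real.cos (2 * γ * Real.log n) = 2 * Real.cos (γ * Real.log n) ^ 2 - 1 := by
    rw [mul_assoc, Real.cos_two_mul]
  rw [hc, Real.cos_zero]
  have : 0 ≤ ((vonMangoldt n : ℝ) * (n : ℝ) ^ (-(1+σ))) * (2 * (1 + Real.cos (γ * Real.log n)) ^ 2) :=
    mul_nonneg hΛ (by positivity)
  nlinarith

theorem ZZ_341 {σ : ℝ} (hσ : 0 < σ) (hσ1 : σ ≤ 1) {γ : ℝ} (hγ : 1 ≤ |γ|) :
    3 * (deriv ZZ (1 + σ) / ZZ (1 + σ)).re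
      + 4 * (deriv ZZ (1 + σ + γ * Complex.I) / ZZ (1 + σ + γ * Complex.I)).re
      + (deriv ZZ (1 + σ + (2 * γ : ℝ) * Complex.I) / ZZ (1 + σ + (2 * γ : ℝ) * Complex.I)).re
    ≤ 3 / σ + 5 := by
  have h := vm_341 hσ γ
  have hL : ∀ t : ℝ, (LSeries (fun n => ((ArithmeticFunction.vonMangoldt n : ℝ) : ℂ)) (1 + σ + t * Complex.I)).re
      = σ / (σ ^ 2 + t ^ 2) - (deriv ZZ (1 + σ + t * Complex.I) / ZZ (1 + σ + t * Complex.I)).re := by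
    intro t
    have hre : 1 < (1 + σ + t * Complex.I : ℂ).re := by simp [hσ]
    have hne : (1 + σ + t * Complex.I : ℂ) ≠ 1 := by
      intro h; rw [h] at hre; simp at hre
    have := ArithmeticFunction.LSeries_vonMangoldt_eq_deriv_riemannZeta_div hre
    rw [this, neg_div, ZZ_logderiv hne (riemannZeta_ne_zero_of_one_lt_re hre)]
    have h3 : (1 / ((1 + σ + t * Complex.I : ℂ) - 1)).re = σ / (σ ^ 2 + t ^ 2) := by
      rw [one_div, Complex.inv_re]
      simp [Complex.normSq_apply]
      ring
    rw [Complex.neg_re, Complex.sub_re, h3]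
    ring
  have h0 := hL 0
  simp only [Complex.ofReal_zero, zero_mul, add_zero] at h0
  rw [h0, hL, hL] at h
  have e0 : σ / (σ ^ 2 + 0 ^ 2) = 1 / σ := by field_simp; ring
  have hg2 : 1 ≤ γ ^ 2 := by rw [← sq_abs]; nlinarith
  have e1 : σ / (σ ^ 2 + γ ^ 2) ≤ 1 := by
    rw [div_le_one (by positivity)]; nlinarith
  have e2 : σ / (σ ^ 2 + (2 * γ) ^ 2) ≤ 1 := by
    rw [div_le_one (by positivity)]; nlinarith
  rw [e0] at h
  have : 3 / σ = 3 * (1 / σ) := by ring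
  rw [this]
  linarith

theorem ZZ_logderiv_real : ∃ C : ℝ, 0 < C ∧ ∀ σ : ℝ, 0 ≤ σ → σ ≤ 1 → 
    -C ≤ (deriv ZZ (1 + σ) / ZZ (1 + σ)).re := by
  have hc : ContinuousOn (fun σ : ℝ => (deriv ZZ (1 + σ) / ZZ (1 + σ)).re) (Set.Icc 0 1) := by
    have hd : Continuous (deriv ZZ) := (ZZ_diff.deriv).continuous
    have hz : Continuous ZZ := ZZ_diff.continuous
    refine Complex.continuous_re.comp_continuousOn (ContinuousOn.div ?_ ?_ ?_)
    · exact (hd.comp (by fun_prop)).continuousOn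
    · exact (hz.comp (by fun_prop)).continuousOn
    · intro x hx
      exact ZZ_ne_zero (by simp [hx.1])
  obtain ⟨C, hC⟩ := isCompact_Icc.exists_bound_of_continuousOn hc
  refine ⟨max C 1, by positivity, fun σ h0 h1 => ?_⟩
  have := hC σ ⟨h0, h1⟩
  have := (abs_le.mp this).1
  linarith [le_max_left C 1]

open Metric in
/-- local lower bounds for the logarithmic derivative -/
theorem ZZ_local {σ t A : ℝ} (hσ : 0 < σ) (hσ1 : σ ≤ 1) (hA : 0 < A)
    (hAt : 144 * (|t| + 4) ^ 2 / σ ^ 2 ≤ Real.exp A) :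
    -(32 * A) ≤ (deriv ZZ (1 + σ + t * Complex.I) / ZZ (1 + σ + t * Complex.I)).re ∧
    ∀ β : ℝ, β < 1 → 3 / 4 + σ ≤ β → ZZ (β + t * Complex.I) = 0 → 
      1 / (σ + 1 - β) - 1 - 32 * A ≤ (deriv ZZ (1 + σ + t * Complex.I) / ZZ (1 + σ + t * Complex.I)).re := by
  set s : ℂ := 1 + σ + t * Complex.I with hs
  have hsre : s.re = 1 + σ := by simp [hs]
  have hsim : s.im = t := by simp [hs]
  set f : ℂ → ℂ := fun w => ZZ (s + w) with hf
  have hfd : Differentiable ℂ f := ZZ_diff.comp (by fun_prop)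
  have hf0 : f 0 = ZZ s := by simp [hf]
  have hf0' : f 0 ≠ 0 := by rw [hf0]; exact ZZ_ne_zero (by rw [hsre]; linarith)
  have hdf : deriv f 0 = deriv ZZ s := by
    have := deriv_comp_const_add (f := ZZ) s 0
    simpa [hf] using this
  have hM : ∀ w ∈ sphere (0:ℂ) (1/2), ‖f w‖ ≤ Real.exp A * ‖f 0‖ := by
    intro w hw
    have hw' : ‖w‖ = 1/2 := by simpa using hw
    have h1 := (abs_le.mp (Complex.abs_re_le_norm w)).1
    have h2 : ‖f w‖ ≤ 3 * (‖s + w‖ + 1) ^ 2 := ZZ_bound (by simp [hsre]; linarith)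
    have h3 : ‖s + w‖ ≤ |t| + 3 := by
      have h4 : ‖s‖ ≤ |s.re| + |s.im| := Complex.norm_le_abs_re_add_abs_im s
      rw [hsre, hsim, abs_of_pos (by linarith)] at h4
      have := norm_add_le s w
      linarith
    have h5 : σ ^ 2 / 48 ≤ ‖f 0‖ := by
      rw [hf0]
      have := ZZ_lower (s := s) (by linarith) (by linarith)
      rwa [hsre, add_sub_cancel_left] at this
    calc ‖f w‖ ≤ 3 * (‖s + w‖ + 1) ^ 2 := h2
      _ ≤ 3 * (|t| + 3 + 1) ^ 2 := by gcongr
      _ = (144 * (|t| + 4) ^ 2 / σ ^ 2) * (σ ^ 2 / 48) := by field_simp; ring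
      _ ≤ Real.exp A * ‖f 0‖ := by gcongr
  have hz : ∀ w ∈ ball (0:ℂ) (1/2/2), f w = 0 → w.re ≤ 0 := by
    intro w _ h
    by_contra hlt
    exact ZZ_ne_zero (s := s + w) (by simp [hsre]; linarith) h
  refine ⟨?_, ?_⟩
  · have := aux_landau (by norm_num) hA hfd hf0' hM hz
    rw [hdf, hf0] at this
    linarith
  · intro β hβ hβ2 hzero
    have := aux_landau_zero (d := σ + 1 - β) (by norm_num) hA hfd hf0' hM hz (by linarith) (by linarith)
      (by
        simp only [hf, hs]
        rw [← hzero]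
        congr 1
        push_cast; ring)
    rw [hdf, hf0] at this
    have e1 : (σ + 1 - β) / (1 / 2) ^ 2 ≤ 1 := by
      rw [div_le_iff₀ (by norm_num)]; linarith
    have e2 : 16 * A / (1 / 2) = 32 * A := by ring
    linarith

theorem ZZ_zero_free_large : ∃ T0 : ℝ, 3 ≤ T0 ∧ ∃ c : ℝ, 0 < c ∧ ∀ β γ : ℝ, T0 ≤ |γ| →
    ZZ (β + γ * Complex.I) = 0 → β < 1 - c / Real.log |γ| := by
  obtain ⟨C, hC0, hC⟩ := ZZ_logderiv_real
  set κ : ℝ := 1 / 1602 with hκ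
  have hev : ∀ᶠ T : ℝ in atTop, 144 * (2 * T + 4) ^ 2 * (Real.log T) ^ 2 ≤ κ ^ 2 * T ^ 5 := by
    have h1 : ∀ᶠ T : ℝ in atTop, Real.log T ≤ T := by
      filter_upwards [eventually_gt_atTop 0] with T hT using (Real.log_le_self hT.le)
    filter_upwards [eventually_ge_atTop (144 * 36 * 1602 ^ 2), h1, eventually_ge_atTop 1] with T hT h1 h2
    have hl := Real.log_nonneg h2
    have : 144 * (2 * T + 4) ^ 2 * (Real.log T) ^ 2 ≤ 144 * (6 * T) ^ 2 * T ^ 2 := by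
      gcongr; linarith
    refine this.trans ?_
    rw [hκ]
    have h4 : 0 ≤ T ^ 4 := by positivity
    nlinarith
  have hlog := Real.tendsto_log_atTop.eventually_ge_atTop (3 * C + 9)
  obtain ⟨T0, hT0⟩ := ((hev.and hlog).and (eventually_ge_atTop (3:ℝ))).exists_forall_of_atTop
  refine ⟨T0, (hT0 T0 le_rfl).2, κ / 8, by rw [hκ]; norm_num, ?_⟩
  intro β γ hγ hzero
  obtain ⟨⟨h1, h2⟩, h3⟩ := hT0 |γ| hγ
  set T := |γ| with hT
  set ℓ := Real.log T with hℓ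
  have hℓ9 : 9 ≤ ℓ := by linarith
  set σ := κ / ℓ with hσ
  have hκ0 : 0 < κ := by rw [hκ]; norm_num
  have hσ0 : 0 < σ := by positivity
  have hσ1 : σ ≤ 1 / 8 := by
    rw [hσ, div_le_iff₀ (by linarith), hκ]; linarith
  by_contra hcon
  push Not at hcon
  have hβ1 : β < 1 := by
    by_contra h
    exact ZZ_ne_zero (s := β + γ * Complex.I) (by simp; linarith) hzero
  have hk8 : κ / 8 / ℓ ≤ 1 / 8 := by
    have : κ / 8 / ℓ = σ / 8 := by rw [hσ]; ring
    rw [this]; linarith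
  have hexp : Real.exp (5 * ℓ) = T ^ 5 := by
    rw [mul_comm, Real.exp_mul, hℓ, Real.exp_log (by linarith)]
    norm_cast
  have hA1 : ∀ t : ℝ, |t| ≤ 2 * T → 144 * (|t| + 4) ^ 2 / σ ^ 2 ≤ Real.exp (5 * ℓ) := by
    intro t ht
    rw [hexp, hσ, div_le_iff₀ (by positivity), div_pow, mul_div_assoc', le_div_iff₀ (by positivity)]
    have : 144 * (|t| + 4) ^ 2 * ℓ ^ 2 ≤ 144 * (2 * T + 4) ^ 2 * ℓ ^ 2 := by gcongr
    linarith
  have hb1 := (ZZ_local hσ0 (by linarith) (by linarith) (hA1 γ (by linarith))).2 β hβ1 (by linarith) hzero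
  have hb2 := (ZZ_local (t := 2 * γ) hσ0 (by linarith) (by linarith) (hA1 (2 * γ) (by
    rw [abs_mul, abs_two]))).1
  have hb3 := hC σ hσ0.le (by linarith)
  have hmain := ZZ_341 hσ0 (by linarith) (γ := γ) (by linarith)
  have hd : 0 < σ + 1 - β := by linarith
  have h4 : 4 * (1 / (σ + 1 - β)) ≤ 3 / σ + 801 * ℓ := by
    have : 4 * (1 / (σ + 1 - β)) ≤ 3 / σ + (3 * C + 9) + 800 * ℓ := by linarith
    linarith
  have h5 : 3 / σ = 4806 * ℓ := by rw [hσ, hκ]; field_simp; norm_num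
  rw [h5] at h4
  have h6 : σ + 1 - β ≤ (9 / 8) * σ := by
    have : κ / 8 / ℓ = σ / 8 := by rw [hσ]; ring
    linarith
  have h7 : 1 / ((9/8) * σ) ≤ 1 / (σ + 1 - β) := by gcongr
  have h8 : 1 / ((9/8) * σ) = (8 / 9) * 1602 * ℓ := by rw [hσ, hκ]; field_simp
  rw [h8] at h7
  linarith

open Metric in
theorem ZZ_zero_free_small (T0 : ℝ) : ∃ δ : ℝ, 0 < δ ∧ ∀ s : ℂ, |s.im| ≤ T0 → 1 - δ < s.re → ZZ s ≠ 0 := by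
  set K : Set ℂ := (fun t : ℝ => 1 + t * Complex.I) '' Set.Icc (-T0) T0
  have hK : IsCompact K := isCompact_Icc.image (by fun_prop)
  have hU : IsOpen {s : ℂ | ZZ s ≠ 0} := isOpen_ne_fun ZZ_diff.continuous continuous_const
  have hKU : K ⊆ {s : ℂ | ZZ s ≠ 0} := by
    rintro _ ⟨t, _, rfl⟩
    exact ZZ_ne_zero (by simp)
  obtain ⟨δ, hδ, h⟩ := hK.exists_thickening_subset_open hU hKU
  refine ⟨δ, hδ, fun s hs1 hs2 => ?_⟩
  by_cases h1 : 1 ≤ s.re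
  · exact ZZ_ne_zero h1
  · apply h
    rw [mem_thickening_iff]
    refine ⟨1 + s.im * Complex.I, ⟨s.im, abs_le.mp hs1, rfl⟩, ?_⟩
    rw [dist_eq_norm]
    have : s - (1 + s.im * Complex.I) = ((s.re - 1 : ℝ) : ℂ) := by
      apply Complex.ext <;> simp
    rw [this, Complex.norm_real, Real.norm_eq_abs, abs_lt]
    constructor <;> linarith

theorem ZZ_zero_free : ∃ c : ℝ, 0 < c ∧ c ≤ 1 / 4 ∧ ∀ T : ℝ, 3 ≤ T → ∀ s : ℂ, |s.im| ≤ T → 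
    1 - c / Real.log T < s.re → ZZ s ≠ 0 := by
  obtain ⟨T0, hT0, c1, hc1, h1⟩ := ZZ_zero_free_large
  obtain ⟨δ, hδ, h2⟩ := ZZ_zero_free_small T0
  refine ⟨min (min c1 δ) (1/4), by positivity, min_le_right _ _, ?_⟩
  intro T hT s hs hre
  set c := min (min c1 δ) (1/4)
  have hcc1 : c ≤ c1 := (min_le_left _ _).trans (min_le_left _ _)
  have hcδ : c ≤ δ := (min_le_left _ _).trans (min_le_right _ _)
  have hc0 : 0 < c := by positivity
  have hlog : 1 ≤ Real.log T := by
    rw [Real.le_log_iff_exp_le (by linarith)]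
    linarith [Real.exp_one_lt_d9]
  by_cases hT' : |s.im| ≤ T0
  · apply h2 s hT'
    have : c / Real.log T ≤ c := div_le_self hc0.le hlog
    linarith
  · push Not at hT'
    intro hz
    have h3 := h1 s.re s.im hT'.le (by rw [Complex.re_add_im]; exact hz)
    have hlog2 : 0 < Real.log |s.im| := Real.log_pos (by linarith)
    have : c / Real.log T ≤ c1 / Real.log |s.im| := by
      gcongr
      linarith
    linarith

open Metric in
theorem ZZ_logderiv_bound : ∃ c : ℝ, 0 < c ∧ c ≤ 1 / 4 ∧ ∀ T : ℝ, 3 ≤ T → ∀ s : ℂ, |s.im| ≤ T → 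
    1 - c / Real.log (T + 1) / 2 ≤ s.re → s.re ≤ 2 → ZZ s ≠ 0 ∧ 
    ‖deriv ZZ s / ZZ s‖ ≤ 9216 * (T + 5) ^ 2 / (c / Real.log (T + 1)) ^ 3 := by
  obtain ⟨c, hc0, hc1, hc⟩ := ZZ_zero_free
  refine ⟨c, hc0, hc1, ?_⟩
  intro T hT s hs hre hre2
  have hlog : 1 ≤ Real.log (T + 1) := by
    rw [Real.le_log_iff_exp_le (by linarith)]
    linarith [Real.exp_one_lt_d9]
  have hzf := hc (T + 1) (by linarith)
  set δ := c / Real.log (T + 1) with hδ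
  have hδ0 : 0 < δ := by positivity
  have hδ1 : δ ≤ 1 / 4 := (div_le_self hc0.le hlog).trans hc1
  set s0 : ℂ := s + (3 / 2 * δ : ℝ) with hs0
  have hs0re : s0.re = s.re + 3 / 2 * δ := by simp [hs0]
  have hs0im : s0.im = s.im := by simp [hs0]
  set f : ℂ → ℂ := fun w => ZZ (s0 + w) with hf
  have hfd : Differentiable ℂ f := ZZ_diff.comp (by fun_prop)
  have hf0 : f 0 = ZZ s0 := by simp [hf]
  set A := 144 * (T + 5) ^ 2 / δ ^ 2 with hA
  have hA0 : 0 < A := by positivity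
  have hlow : δ ^ 2 / 48 ≤ ‖f 0‖ := by
    rw [hf0]
    refine le_trans ?_ (ZZ_lower (s := s0) (by linarith) (by linarith))
    have : δ ≤ s0.re - 1 := by linarith
    gcongr
  have hw : ∀ w ∈ ball (0:ℂ) (2 * δ), |w.re| < 2 * δ ∧ |w.im| < 2 * δ ∧ ‖w‖ < 2 * δ := by
    intro w hw
    have h1 : ‖w‖ < 2 * δ := by simpa using hw
    exact ⟨(Complex.abs_re_le_norm w).trans_lt h1, (Complex.abs_im_le_norm w).trans_lt h1, h1⟩
  have hne : ∀ w ∈ ball (0:ℂ) (2 * δ), f w ≠ 0 := by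
    intro w hw'
    obtain ⟨h1, h2, h3⟩ := hw w hw'
    apply hzf
    · rw [Complex.add_im, hs0im]
      exact (abs_add_le _ _).trans (by linarith)
    · rw [Complex.add_re, hs0re]
      linarith [(abs_lt.mp h1).1]
  have hb : ∀ w ∈ ball (0:ℂ) (2 * δ), ‖f w‖ ≤ Real.exp A * ‖f 0‖ := by
    intro w hw'
    obtain ⟨h1, h2, h3⟩ := hw w hw'
    have h4 : ‖f w‖ ≤ 3 * (‖s0 + w‖ + 1) ^ 2 := ZZ_bound (by
      rw [Complex.add_re, hs0re]
      linarith [(abs_lt.mp h1).1])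
    have h5 : ‖s0 + w‖ ≤ T + 4 := by
      have h6 : ‖s0‖ ≤ |s0.re| + |s0.im| := Complex.norm_le_abs_re_add_abs_im s0
      rw [hs0re, hs0im, abs_of_pos (by linarith)] at h6
      have := norm_add_le s0 w
      linarith
    calc ‖f w‖ ≤ 3 * (‖s0 + w‖ + 1) ^ 2 := h4
      _ ≤ 3 * (T + 4 + 1) ^ 2 := by gcongr
      _ = A * (δ ^ 2 / 48) := by rw [hA]; field_simp; ring
      _ ≤ Real.exp A * ‖f 0‖ := by
        gcongr
        linarith [Real.add_one_le_exp A]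
  have hzmem : ((-(3 / 2 * δ) : ℝ) : ℂ) ∈ ball (0:ℂ) (2 * δ) := by
    rw [mem_ball_zero_iff, Complex.norm_real, Real.norm_eq_abs, abs_neg, abs_of_pos (by positivity)]
    linarith
  have hfs : f ((-(3 / 2 * δ) : ℝ) : ℂ) = ZZ s := by
    simp only [hf, hs0]; congr 1; push_cast; ring
  have hdf : deriv f ((-(3 / 2 * δ) : ℝ) : ℂ) = deriv ZZ s := by
    have := deriv_comp_const_add (f := ZZ) s0 ((-(3 / 2 * δ) : ℝ) : ℂ)
    rw [hf, this]
    simp only [hs0]; congr 1; push_cast; ring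
  refine ⟨by rw [← hfs]; exact hne _ hzmem, ?_⟩
  have := aux_log_deriv hA0 hfd.differentiableOn hne hb hzmem
  rw [hfs, hdf, Complex.norm_real, Real.norm_eq_abs, abs_neg, abs_of_pos (by positivity)] at this
  refine this.trans (le_of_eq ?_)
  rw [hA]
  have : 2 * δ - 3 / 2 * δ = δ / 2 := by ring
  rw [this]
  field_simp
  ring

/-- Gaussian density with standard deviation `η` -/
noncomputable def gs (η v : ℝ) : ℝ := Real.exp (-v ^ 2 / (2 * η ^ 2)) / (η * Real.sqrt (2 * Real.pi))

theorem gs_nonneg {η : ℝ} (hη : 0 < η) (v : ℝ) : 0 ≤ gs η v := by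
  unfold gs; positivity

theorem gs_neg (η v : ℝ) : gs η (-v) = gs η v := by
  unfold gs; simp

theorem gs_eq (η v : ℝ) : gs η v = Real.exp (-(1 / (2 * η ^ 2)) * v ^ 2) / (η * Real.sqrt (2 * Real.pi)) := by
  unfold gs; congr 2; ring

theorem gs_integrable {η : ℝ} (hη : 0 < η) : MeasureTheory.Integrable (gs η) := by
  have h := (integrable_exp_neg_mul_sq (b := 1 / (2 * η ^ 2)) (by positivity)).div_const (η * Real.sqrt (2 * Real.pi))
  exact h.congr (Eventually.of_forall fun v => (gs_eq η v).symm)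

theorem gs_integral {η : ℝ} (hη : 0 < η) : ∫ v, gs η v = 1 := by
  simp_rw [gs_eq]
  rw [MeasureTheory.integral_div, integral_gaussian, div_eq_one_iff_eq (by positivity)]
  rw [show Real.pi / (1 / (2 * η ^ 2)) = η ^ 2 * (2 * Real.pi) by field_simp,
    Real.sqrt_mul (by positivity), Real.sqrt_sq hη.le]

theorem gs_cont {η : ℝ} : Continuous (gs η) := by
  unfold gs; fun_prop

theorem gs_tail {η ε v : ℝ} (hη : 0 < η) (hε : 0 ≤ ε) (hv : ε ≤ |v|) :
    gs η v ≤ Real.sqrt 2 * Real.exp (-ε ^ 2 / (4 * η ^ 2)) * gs (Real.sqrt 2 * η) v := by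
  unfold gs
  have h2 : Real.sqrt 2 ^ 2 = 2 := Real.sq_sqrt (by norm_num)
  have hs : 0 < Real.sqrt 2 := by positivity
  have e1 : Real.sqrt 2 * Real.exp (-ε ^ 2 / (4 * η ^ 2)) * (Real.exp (-v ^ 2 / (2 * (Real.sqrt 2 * η) ^ 2)) /
    (Real.sqrt 2 * η * Real.sqrt (2 * Real.pi))) = Real.exp (-ε ^ 2 / (4 * η ^ 2) + -v ^ 2 / (4 * η ^ 2))
      / (η * Real.sqrt (2 * Real.pi)) := by
    rw [Real.exp_add, mul_pow, h2, show 2 * (2 * η ^ 2) = 4 * η ^ 2 by ring]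
    field_simp
  rw [e1]
  gcongr
  have : ε ^ 2 ≤ v ^ 2 := by rw [← sq_abs v]; gcongr
  have e3 : -v ^ 2 / (2 * η ^ 2) = (-v ^ 2 + -v ^ 2) / (4 * η ^ 2) := by field_simp; ring
  rw [e3, ← add_div]
  gcongr

/-- the kernel -/
noncomputable def KK (η U : ℝ) (s : ℂ) : ℂ := Complex.exp (η ^ 2 * s ^ 2 / 2 + s * U)

theorem KK_norm (η U x t : ℝ) : ‖KK η U (x + t * Complex.I)‖ =
    Real.exp (η ^ 2 * (x ^ 2 - t ^ 2) / 2 + x * U) := by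
  unfold KK
  rw [Complex.norm_exp]
  congr 1
  have : (η ^ 2 * (x + t * Complex.I) ^ 2 / 2 + (x + t * Complex.I) * U : ℂ)
    = ((η ^ 2 * (x ^ 2 - t ^ 2) / 2 + x * U : ℝ) : ℂ) + ((η ^ 2 * x * t + t * U : ℝ) : ℂ) * Complex.I := by
    push_cast
    linear_combination (η ^ 2 * t ^ 2 / 2 : ℂ) * Complex.I_sq
  rw [this, Complex.add_re, Complex.ofReal_re, Complex.re_ofReal_mul, Complex.I_re, mul_zero, add_zero]

theorem KK_norm1 (η U t : ℝ) : ‖KK η U (1 + t * Complex.I)‖ =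
    Real.exp (η ^ 2 / 2 + U) * Real.exp (-(η ^ 2 / 2) * t ^ 2) := by
  have := KK_norm η U 1 t
  rw [Complex.ofReal_one] at this
  rw [this, ← Real.exp_add]; congr 1; ring

theorem KK_quad (η U t : ℝ) : KK η U (1 + t * Complex.I) =
    Complex.exp ((-(η ^ 2 / 2) : ℂ) * t ^ 2 + ((η ^ 2 + U) * Complex.I) * t + (η ^ 2 / 2 + U)) := by
  unfold KK; congr 1
  linear_combination (η ^ 2 * t ^ 2 / 2 : ℂ) * Complex.I_sq

theorem KK_re_neg {η : ℝ} (hη : 0 < η) : (-(η ^ 2 / 2) : ℂ).re < 0 := by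
  have : (-(η ^ 2 / 2) : ℂ) = ((-(η ^ 2 / 2) : ℝ) : ℂ) := by push_cast; ring
  rw [this, Complex.ofReal_re]
  have : 0 < η ^ 2 := by positivity
  linarith

theorem KK_integrable {η : ℝ} (hη : 0 < η) (U : ℝ) :
    MeasureTheory.Integrable (fun t : ℝ => KK η U (1 + t * Complex.I)) := by
  simp_rw [KK_quad]
  exact integrable_cexp_quadratic' (KK_re_neg hη) _ _

theorem KK_integral {η : ℝ} (hη : 0 < η) (U : ℝ) :
    ∫ t : ℝ, KK η U (1 + t * Complex.I) = ((2 * Real.pi * gs η U : ℝ) : ℂ) := by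
  simp_rw [KK_quad]
  rw [integral_cexp_quadratic (KK_re_neg hη)]
  have hη0 : (η : ℂ) ≠ 0 := by exact_mod_cast hη.ne'
  have e1 : (η ^ 2 / 2 + U - ((η ^ 2 + U) * Complex.I) ^ 2 / (4 * (-(η ^ 2 / 2))) : ℂ)
      = ((-U ^ 2 / (2 * η ^ 2) : ℝ) : ℂ) := by
    push_cast
    rw [mul_pow, Complex.I_sq]
    field_simp
    ring
  have e2 : ((Real.pi : ℂ) / -(-(η ^ 2 / 2))) = ((2 * Real.pi / η ^ 2 : ℝ) : ℂ) := by
    push_cast; field_simp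
  rw [e1, e2, ← Complex.ofReal_exp]
  have e3 : (1 / 2 : ℂ) = ((1 / 2 : ℝ) : ℂ) := by push_cast; ring
  rw [e3, ← Complex.ofReal_cpow (by positivity), ← Complex.ofReal_mul]
  congr 1
  rw [← Real.sqrt_eq_rpow, Real.sqrt_div (by positivity), Real.sqrt_sq hη.le]
  unfold gs
  have : Real.sqrt (2 * Real.pi) ^ 2 = 2 * Real.pi := Real.sq_sqrt (by positivity)
  field_simp
  rw [this]

theorem KK_shift (η U v : ℝ) (s : ℂ) : KK η U s * Complex.exp (-s * v) = KK η (U - v) s := by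
  unfold KK; rw [← Complex.exp_add]; congr 1; push_cast; ring

theorem KK_cont (η U : ℝ) : Continuous (KK η U) := by unfold KK; fun_prop

open MeasureTheory in
theorem KK_main {η : ℝ} (hη : 0 < η) (U : ℝ) :
    ∫ t : ℝ, KK η U (1 + t * Complex.I) * (1 / (1 + t * Complex.I)) =
      ((2 * Real.pi * ∫ v in Set.Ioi (0:ℝ), gs η (U - v) : ℝ) : ℂ) := by
  have h1 : ∀ t : ℝ, KK η U (1 + t * Complex.I) * (1 / (1 + t * Complex.I)) =
      ∫ v in Set.Ioi (0:ℝ), KK η (U - v) (1 + t * Complex.I) := by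
    intro t
    have := integral_exp_mul_complex_Ioi (a := -(1 + t * Complex.I)) (by simp) 0
    simp_rw [← KK_shift]
    rw [integral_const_mul, this]
    congr 1
    rw [Complex.ofReal_zero, mul_zero, Complex.exp_zero, neg_div_neg_eq]
  simp_rw [h1]
  have hIntg : Integrable (Function.uncurry fun (t v : ℝ) => KK η (U - v) (1 + t * Complex.I))
      (volume.prod (volume.restrict (Set.Ioi (0:ℝ)))) := by
    have hA := KK_integrable hη U
    have hB : Integrable (fun v : ℝ => Real.exp (-1 * v)) (volume.restrict (Set.Ioi (0:ℝ))) :=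
      integrableOn_exp_mul_Ioi (by norm_num) 0
    refine (hA.norm.mul_prod hB).mono' ?_ ?_
    · apply Continuous.aestronglyMeasurable
      unfold KK
      fun_prop
    · refine Eventually.of_forall fun p => ?_
      obtain ⟨t, v⟩ := p
      simp only [Function.uncurry]
      rw [← KK_shift, norm_mul, Complex.norm_exp]
      simp
  rw [integral_integral_swap hIntg]
  simp_rw [KK_integral hη]
  rw [integral_complex_ofReal, integral_const_mul]

open MeasureTheory in
theorem gs_half {η U : ℝ} (hη : 0 < η) (hU : 0 ≤ U) :
    (∫ v in Set.Ioi (0:ℝ), gs η (U - v)) ≤ 1 ∧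
    1 - Real.sqrt 2 * Real.exp (-U ^ 2 / (4 * η ^ 2)) ≤ ∫ v in Set.Ioi (0:ℝ), gs η (U - v) := by
  have hi : ∀ η : ℝ, 0 < η → Integrable (fun v => gs η (U - v)) := fun η h => (gs_integrable h).comp_sub_left U
  have ht : ∀ η : ℝ, 0 < η → ∫ v, gs η (U - v) = 1 := fun η h => by
    rw [integral_sub_left_eq_self (gs η) volume U, gs_integral h]
  constructor
  · rw [← ht η hη]
    exact setIntegral_le_integral (hi η hη) (Eventually.of_forall fun v => gs_nonneg hη _)
  · have h1 := integral_add_compl (measurableSet_Ioi (a := (0:ℝ))) (hi η hη)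
    rw [ht η hη] at h1
    have hη2 : 0 < Real.sqrt 2 * η := by positivity
    have h2 : ∫ v in (Set.Ioi (0:ℝ))ᶜ, gs η (U - v) ≤
        ∫ v in (Set.Ioi (0:ℝ))ᶜ, Real.sqrt 2 * Real.exp (-U ^ 2 / (4 * η ^ 2)) * gs (Real.sqrt 2 * η) (U - v) := by
      refine setIntegral_mono_on (hi η hη).integrableOn ((hi _ hη2).const_mul _).integrableOn
        measurableSet_Ioi.compl fun v hv => ?_
      refine gs_tail hη hU ?_
      simp at hv
      rw [abs_of_nonneg] <;> linarith
    have h3 : ∫ v in (Set.Ioi (0:ℝ))ᶜ, Real.sqrt 2 * Real.exp (-U ^ 2 / (4 * η ^ 2)) * gs (Real.sqrt 2 * η) (U - v)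
        ≤ Real.sqrt 2 * Real.exp (-U ^ 2 / (4 * η ^ 2)) := by
      rw [integral_const_mul]
      have : ∫ v in (Set.Ioi (0:ℝ))ᶜ, gs (Real.sqrt 2 * η) (U - v) ≤ 1 := by
        rw [← ht _ hη2]
        exact setIntegral_le_integral (hi _ hη2) (Eventually.of_forall fun v => gs_nonneg hη2 _)
      exact mul_le_of_le_one_right (by positivity) this
    linarith

open ArithmeticFunction in
/-- summation of the Gaussian-weighted von Mangoldt function -/
theorem vm_term (η U : ℝ) (n : ℕ) (t : ℝ) :
    LSeries.term (fun n => ((vonMangoldt n : ℝ) : ℂ)) (2 + t * Complex.I) n * KK η U (1 + t * Complex.I)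
      = ((vonMangoldt n / n : ℝ) : ℂ) * KK η (U - Real.log n) (1 + t * Complex.I) := by
  rcases Nat.eq_zero_or_pos n with rfl | hn
  · simp
  have hn0 : (n : ℂ) ≠ 0 := by exact_mod_cast hn.ne'
  have hnr : (0:ℝ) < n := by exact_mod_cast hn
  rw [LSeries.term_of_ne_zero hn.ne', ← KK_shift, div_eq_mul_inv, ← Complex.cpow_neg,
    show (-(2 + t * Complex.I) : ℂ) = -1 + -(1 + t * Complex.I) by ring, Complex.cpow_add _ _ hn0,
    Complex.cpow_neg_one, Complex.cpow_def_of_ne_zero hn0, ← Complex.ofReal_natCast,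
    ← Complex.ofReal_log hnr.le, mul_comm (Real.log n : ℂ)]
  push_cast
  ring

noncomputable def DD : ℝ := ∑' n : ℕ, ‖LSeries.term (fun n => ((ArithmeticFunction.vonMangoldt n : ℝ) : ℂ)) 2 n‖

theorem term_norm2 (n : ℕ) (t : ℝ) :
   ‖LSeries.term (fun n => ((ArithmeticFunction.vonMangoldt n : ℝ) : ℂ)) (2 + t * Complex.I) n‖ =
   ‖LSeries.term (fun n => ((ArithmeticFunction.vonMangoldt n : ℝ) : ℂ)) 2 n‖ := by
  simp [LSeries.norm_term_eq]

theorem DD_summable : Summable fun n : ℕ => ‖LSeries.term (fun n => ((ArithmeticFunction.vonMangoldt n : ℝ) : ℂ)) 2 n‖ := by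
  have : LSeriesSummable (fun n => ((ArithmeticFunction.vonMangoldt n : ℝ) : ℂ)) 2 :=
    ArithmeticFunction.LSeriesSummable_vonMangoldt (by simp)
  exact this.norm

theorem DD_bound (t : ℝ) : ‖LSeries (fun n => ((ArithmeticFunction.vonMangoldt n : ℝ) : ℂ)) (2 + t * Complex.I)‖ ≤ DD := by
  unfold LSeries DD
  simp_rw [← term_norm2 _ t]
  exact norm_tsum_le_tsum_norm (by simp_rw [term_norm2]; exact DD_summable)

open ArithmeticFunction MeasureTheory in
theorem vm_hasSum {η : ℝ} (hη : 0 < η) (U : ℝ) :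
    HasSum (fun n : ℕ => ((vonMangoldt n / n * (2 * Real.pi * gs η (U - Real.log n)) : ℝ) : ℂ))
      (∫ t : ℝ, LSeries (fun n => ((vonMangoldt n : ℝ) : ℂ)) (2 + t * Complex.I) * KK η U (1 + t * Complex.I)) := by
  have key := hasSum_integral_of_summable_integral_norm (μ := (volume : Measure ℝ))
    (F := fun (n : ℕ) (t : ℝ) =>
      LSeries.term (fun n => ((vonMangoldt n : ℝ) : ℂ)) (2 + t * Complex.I) n * KK η U (1 + t * Complex.I))
    (by
      intro n
      simp_rw [vm_term]
      exact (KK_integrable hη _).const_mul _)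
    (by
      simp_rw [norm_mul, term_norm2, integral_const_mul]
      exact DD_summable.mul_right _)
  simp_rw [tsum_mul_right] at key
  have e : (fun n : ℕ => ((vonMangoldt n / n * (2 * Real.pi * gs η (U - Real.log n)) : ℝ) : ℂ)) =
      fun n : ℕ => ∫ t : ℝ, LSeries.term (fun n => ((vonMangoldt n : ℝ) : ℂ)) (2 + t * Complex.I) n *
        KK η U (1 + t * Complex.I) := by
    funext n
    simp_rw [vm_term, integral_const_mul, KK_integral hη]
    push_cast
    rfl
  rw [e]
  exact key

open ArithmeticFunction in
theorem LS_eq (t : ℝ) : LSeries (fun n => ((vonMangoldt n : ℝ) : ℂ)) (2 + t * Complex.I)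
    = 1 / (1 + t * Complex.I) - deriv ZZ (2 + t * Complex.I) / ZZ (2 + t * Complex.I) := by
  have hre : 1 < (2 + t * Complex.I : ℂ).re := by simp
  have hne : (2 + t * Complex.I : ℂ) ≠ 1 := by
    intro h; rw [h] at hre; simp at hre
  rw [LSeries_vonMangoldt_eq_deriv_riemannZeta_div hre, neg_div,
    ZZ_logderiv hne (riemannZeta_ne_zero_of_one_lt_re hre)]
  rw [show (2 + t * Complex.I - 1 : ℂ) = 1 + t * Complex.I by ring]
  ring

theorem FF_bound1 (t : ℝ) : ‖deriv ZZ (2 + t * Complex.I) / ZZ (2 + t * Complex.I)‖ ≤ DD + 1 := by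
  have h1 := LS_eq t
  have h2 : deriv ZZ (2 + t * Complex.I) / ZZ (2 + t * Complex.I) = 1 / (1 + t * Complex.I) -
    LSeries (fun n => ((ArithmeticFunction.vonMangoldt n : ℝ) : ℂ)) (2 + t * Complex.I) := by
    rw [h1]; ring
  rw [h2]
  refine (norm_sub_le _ _).trans ?_
  have h3 : ‖(1 / (1 + t * Complex.I) : ℂ)‖ ≤ 1 := by
    rw [norm_div, norm_one]
    have := Complex.abs_re_le_norm (1 + t * Complex.I)
    simp at this
    rw [div_le_one (by linarith)]
    exact this
  linarith [DD_bound t]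

theorem DD_nonneg : 0 ≤ DD := tsum_nonneg fun _ => norm_nonneg _

theorem FF_cont : Continuous fun t : ℝ => deriv ZZ (2 + t * Complex.I) / ZZ (2 + t * Complex.I) := by
  have hd : Continuous (deriv ZZ) := (ZZ_diff.deriv).continuous
  have hz : Continuous ZZ := ZZ_diff.continuous
  exact (hd.comp (by fun_prop)).div (hz.comp (by fun_prop)) fun t => ZZ_ne_zero (by simp)

open ArithmeticFunction MeasureTheory in
theorem vm_error {η : ℝ} (hη : 0 < η) (U : ℝ) :
    HasSum (fun n : ℕ => vonMangoldt n / n * gs η (U - Real.log n))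
      ((∫ v in Set.Ioi (0:ℝ), gs η (U - v)) - (1 / (2 * Real.pi)) *
        (∫ t : ℝ, deriv ZZ (2 + t * Complex.I) / ZZ (2 + t * Complex.I) * KK η U (1 + t * Complex.I)).re) := by
  have hK := KK_integrable hη U
  have h1 := vm_hasSum hη U
  simp_rw [LS_eq, sub_mul] at h1
  have hi1 : Integrable fun t : ℝ => 1 / (1 + t * Complex.I) * KK η U (1 + t * Complex.I) := by
    refine hK.bdd_mul (c := 1) ?_ (Eventually.of_forall fun t => ?_)
    · apply Continuous.aestronglyMeasurable
      refine continuous_const.div (by fun_prop) fun t h => ?_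
      have := congrArg Complex.re h
      simp at this
    · rw [norm_div, norm_one]
      have := Complex.abs_re_le_norm (1 + t * Complex.I)
      simp at this
      rw [div_le_one (by linarith)]
      exact this
  have hi2 : Integrable fun t : ℝ => deriv ZZ (2 + t * Complex.I) / ZZ (2 + t * Complex.I) * KK η U (1 + t * Complex.I) :=
    hK.bdd_mul FF_cont.aestronglyMeasurable (Eventually.of_forall FF_bound1)
  rw [integral_sub hi1 hi2] at h1
  have h2 := KK_main hη U
  simp_rw [mul_comm (KK _ _ _)] at h2
  rw [h2] at h1
  have h3 := (Complex.hasSum_re h1).mul_left (1 / (2 * Real.pi))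
  simp only [Complex.ofReal_re, Complex.sub_re] at h3
  have hpi := Real.pi_pos
  have e1 : (fun n : ℕ => vonMangoldt n / n * gs η (U - Real.log n)) =
      fun n : ℕ => 1 / (2 * Real.pi) * (vonMangoldt n / n * (2 * Real.pi * gs η (U - Real.log n))) := by
    funext n; field_simp
  rw [e1]
  have e2 : ∀ A B : ℝ, A - 1 / (2 * Real.pi) * B = 1 / (2 * Real.pi) * (2 * Real.pi * A - B) := by
    intro A B; field_simp
  rw [e2]
  exact h3

open MeasureTheory in
theorem EE_tail {η U T : ℝ} (hη : 0 < η) (hη1 : η ≤ 2) (hT : 0 < T) :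
    ‖∫ t in (Set.Ioc (-T) T)ᶜ, deriv ZZ (2 + t * Complex.I) / ZZ (2 + t * Complex.I) * KK η U (1 + t * Complex.I)‖
      ≤ (DD + 1) * (Real.exp (2 + U - η ^ 2 * T ^ 2 / 4) * (4 / η)) := by
  have hg : Integrable fun t : ℝ => (DD + 1) * Real.exp (2 + U - η ^ 2 * T ^ 2 / 4) * Real.exp (-(η ^ 2 / 4) * t ^ 2) :=
    (integrable_exp_neg_mul_sq (by positivity)).const_mul _
  have hD := DD_nonneg
  refine (norm_integral_le_of_norm_le hg.integrableOn (g := fun t : ℝ => (DD + 1) * Real.exp (2 + U - η ^ 2 * T ^ 2 / 4) * Real.exp (-(η ^ 2 / 4) * t ^ 2)) ?_).trans ?_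
  · refine (ae_restrict_mem measurableSet_Ioc.compl).mono fun t ht => ?_
    rw [norm_mul, KK_norm1, mul_assoc]
    refine mul_le_mul (FF_bound1 t) ?_ (by positivity) (by positivity)
    rw [← Real.exp_add, ← Real.exp_add]
    apply Real.exp_le_exp.mpr
    have ht2 : T ^ 2 ≤ t ^ 2 := by
      rw [← sq_abs t]
      have : T ≤ |t| := by
        by_contra h
        push Not at h
        rw [abs_lt] at h
        exact ht ⟨h.1, h.2.le⟩
      gcongr
    have h3 : η ^ 2 * T ^ 2 ≤ η ^ 2 * t ^ 2 := by gcongr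
    nlinarith
  · refine (setIntegral_le_integral hg (Eventually.of_forall fun t => by positivity)).trans ?_
    rw [integral_const_mul, integral_gaussian, mul_assoc]
    gcongr
    rw [show Real.pi / (η ^ 2 / 4) = Real.pi * (2 / η) ^ 2 by field_simp; ring, Real.sqrt_mul Real.pi_pos.le,
      Real.sqrt_sq (by positivity)]
    have : Real.sqrt Real.pi ≤ 2 := by
      rw [Real.sqrt_le_left (by norm_num)]; linarith [Real.pi_lt_four]
    calc Real.sqrt Real.pi * (2 / η) ≤ 2 * (2 / η) := by gcongr
      _ = 4 / η := by ring

theorem EE_rect {η U T δ B : ℝ} (hη : 0 < η) (hη1 : η ≤ 2) (hT : 0 < T) (hδ : 0 < δ) (hδ1 : δ ≤ 1) (hU : 0 ≤ U)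
    (hB : ∀ s : ℂ, |s.im| ≤ T → 1 - δ ≤ s.re → s.re ≤ 2 → ZZ s ≠ 0 ∧ ‖deriv ZZ s / ZZ s‖ ≤ B) :
    ‖∫ t in (-T)..T, deriv ZZ (2 + t * Complex.I) / ZZ (2 + t * Complex.I) * KK η U (1 + t * Complex.I)‖
      ≤ 4 * (B * Real.exp (2 + U - η ^ 2 * T ^ 2 / 2)) + 2 * T * (B * Real.exp (2 - δ * U)) := by
  set f : ℂ → ℂ := fun s => deriv ZZ (1 + s) / ZZ (1 + s) * KK η U s with hf
  have hB0 : 0 ≤ B := (norm_nonneg _).trans (hB 1 (by simp [hT.le]) (by simp [hδ.le]) (by simp)).2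
  have hη2 : η ^ 2 ≤ 4 := by nlinarith
  have hη0 : 0 < η ^ 2 := by positivity
  have hdiff : DifferentiableOn ℂ f (Set.uIcc (-δ + (-T) * Complex.I : ℂ).re (1 + T * Complex.I : ℂ).re ×ℂ
      Set.uIcc (-δ + (-T) * Complex.I : ℂ).im (1 + T * Complex.I : ℂ).im) := by
    intro s hs
    simp [Complex.mem_reProdIm, Set.uIcc_of_le (show -δ ≤ 1 by linarith), Set.uIcc_of_le (show -T ≤ T by linarith)] at hs
    have hne := (hB (1 + s) (by simpa [abs_le] using hs.2) (by simp; linarith [hs.1.1]) (by simp; linarith [hs.1.2])).1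
    have h1 : DifferentiableAt ℂ (fun s => deriv ZZ (1 + s)) s :=
      (ZZ_diff.deriv.comp (by fun_prop : Differentiable ℂ fun s : ℂ => 1 + s)) s
    have h2 : DifferentiableAt ℂ (fun s => ZZ (1 + s)) s :=
      (ZZ_diff.comp (by fun_prop : Differentiable ℂ fun s : ℂ => 1 + s)) s
    have h3 : DifferentiableAt ℂ (KK η U) s := by unfold KK; fun_prop
    exact ((h1.div h2 hne).mul h3).differentiableWithinAt
  have key := Complex.integral_boundary_rect_eq_zero_of_differentiableOn f _ _ hdiff
  simp only [Complex.add_re, Complex.neg_re, Complex.ofReal_re, Complex.mul_re, Complex.ofReal_im, Complex.I_re,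
    Complex.I_im, Complex.neg_im, Complex.add_im, Complex.mul_im, Complex.one_re, Complex.one_im, mul_zero, mul_one,
    zero_mul, sub_zero, add_zero, zero_add, neg_zero, sub_self, smul_eq_mul] at key
  have hfb : ∀ x t : ℝ, -δ ≤ x → x ≤ 1 → |t| ≤ T → ‖f (x + t * Complex.I)‖ ≤
      B * Real.exp (η ^ 2 * (x ^ 2 - t ^ 2) / 2 + x * U) := by
    intro x t h1 h2 h3
    simp only [hf]
    rw [norm_mul, KK_norm]
    gcongr
    exact (hB _ (by simpa using h3) (by simp; linarith) (by simp; linarith)).2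
  have hhor : ∀ t : ℝ, |t| = T → ‖∫ x in (-δ)..1, f (x + t * Complex.I)‖ ≤ 2 * (B * Real.exp (2 + U - η ^ 2 * T ^ 2 / 2)) := by
    intro t ht
    have := intervalIntegral.norm_integral_le_of_norm_le_const (a := -δ) (b := 1) (f := fun x : ℝ => f (x + t * Complex.I))
      (C := B * Real.exp (2 + U - η ^ 2 * T ^ 2 / 2)) (by
        intro x hx
        rw [Set.uIoc_of_le (by linarith)] at hx
        refine (hfb x t hx.1.le hx.2 ht.le).trans ?_
        gcongr
        have h4 : x ^ 2 ≤ 1 := by nlinarith [hx.1, hx.2]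
        have h5 : t ^ 2 = T ^ 2 := by rw [← ht, sq_abs]
        have h6 : x * U ≤ U := by nlinarith [hx.2]
        rw [h5]
        nlinarith)
    refine this.trans ?_
    rw [mul_comm]
    gcongr
    rw [abs_of_nonneg] <;> linarith
  have hleft : ‖∫ t in (-T)..T, f (((-δ : ℝ) : ℂ) + t * Complex.I)‖ ≤ 2 * T * (B * Real.exp (2 - δ * U)) := by
    have := intervalIntegral.norm_integral_le_of_norm_le_const (a := -T) (b := T) (f := fun t : ℝ => f (((-δ : ℝ) : ℂ) + t * Complex.I))
      (C := B * Real.exp (2 - δ * U)) (by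
        intro t ht
        rw [Set.uIoc_of_le (by linarith)] at ht
        refine (hfb (-δ) t le_rfl (by linarith) (abs_le.mpr ⟨ht.1.le, ht.2⟩)).trans ?_
        gcongr
        have h4 : δ ^ 2 ≤ 1 := by nlinarith
        have h5 : 0 ≤ η ^ 2 * t ^ 2 := by positivity
        nlinarith)
    refine this.trans ?_
    rw [mul_comm]
    gcongr
    rw [abs_of_nonneg] <;> linarith
  have e : (∫ t in (-T)..T, deriv ZZ (2 + t * Complex.I) / ZZ (2 + t * Complex.I) * KK η U (1 + t * Complex.I))
      = ∫ t in (-T)..T, f (((1 : ℝ) : ℂ) + t * Complex.I) := by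
    congr 1; funext t
    simp only [hf, Complex.ofReal_one]
    rw [show (1 + (1 + t * Complex.I) : ℂ) = 2 + t * Complex.I by ring]
  rw [e]
  have h1 := hhor (-T) (by rw [abs_neg, abs_of_pos hT])
  have h2 := hhor T (abs_of_pos hT)
  set I1 := ∫ x in (-δ)..1, f (x + (-T : ℝ) * Complex.I)
  set I2 := ∫ x in (-δ)..1, f (x + T * Complex.I)
  set I3 := ∫ t in (-T)..T, f (((1 : ℝ) : ℂ) + t * Complex.I)
  set I4 := ∫ t in (-T)..T, f (((-δ : ℝ) : ℂ) + t * Complex.I)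
  have h3 : Complex.I * I3 = I2 - I1 + Complex.I * I4 := by linear_combination key
  have h4 : ‖I3‖ = ‖Complex.I * I3‖ := by simp
  rw [h4, h3]
  calc ‖I2 - I1 + Complex.I * I4‖ ≤ ‖I2 - I1‖ + ‖Complex.I * I4‖ := norm_add_le _ _
    _ ≤ ‖I2‖ + ‖I1‖ + ‖I4‖ := by
      have := norm_sub_le I2 I1
      have h5 : ‖Complex.I * I4‖ = ‖I4‖ := by simp
      linarith
    _ ≤ _ := by linarith

open MeasureTheory in
theorem EE_total {η U T δ B : ℝ} (hη : 0 < η) (hη1 : η ≤ 2) (hT : 0 < T) (hδ : 0 < δ) (hδ1 : δ ≤ 1) (hU : 0 ≤ U)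
    (hB : ∀ s : ℂ, |s.im| ≤ T → 1 - δ ≤ s.re → s.re ≤ 2 → ZZ s ≠ 0 ∧ ‖deriv ZZ s / ZZ s‖ ≤ B) :
    ‖∫ t : ℝ, deriv ZZ (2 + t * Complex.I) / ZZ (2 + t * Complex.I) * KK η U (1 + t * Complex.I)‖
      ≤ 4 * (B * Real.exp (2 + U - η ^ 2 * T ^ 2 / 2)) + 2 * T * (B * Real.exp (2 - δ * U))
       + (DD + 1) * (Real.exp (2 + U - η ^ 2 * T ^ 2 / 4) * (4 / η)) := by
  have hi2 : Integrable fun t : ℝ => deriv ZZ (2 + t * Complex.I) / ZZ (2 + t * Complex.I) * KK η U (1 + t * Complex.I) :=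
    (KK_integrable hη U).bdd_mul FF_cont.aestronglyMeasurable (Eventually.of_forall FF_bound1)
  rw [← integral_add_compl (measurableSet_Ioc (a := -T) (b := T)) hi2]
  refine (norm_add_le _ _).trans (add_le_add ?_ (EE_tail hη hη1 hT))
  have := EE_rect hη hη1 hT hδ hδ1 hU hB
  rwa [intervalIntegral.integral_of_le (by linarith)] at this

set_option maxHeartbeats 1000000 in
open ArithmeticFunction in
theorem gauss_pnt : ∃ z0 : ℝ, 1 ≤ z0 ∧ ∀ z : ℝ, z0 ≤ z → ∀ U η : ℝ, z ^ 3 ≤ U → U ≤ 2 * z ^ 3 →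
    Real.exp (-4 * z) ≤ η → η ≤ 2 →
    Summable (fun n : ℕ => vonMangoldt n / n * gs η (U - Real.log n)) ∧
    |(∑' n : ℕ, vonMangoldt n / n * gs η (U - Real.log n)) - 1| ≤ Real.exp (-3 * z) := by
  obtain ⟨c, hc0, hc1, hc⟩ := ZZ_logderiv_bound
  have hD := DD_nonneg
  set M : ℝ := 9216 * 36 * 216 / c ^ 3 with hM
  have hM0 : 0 < M := by positivity
  obtain ⟨m, hm0, hmM, hmD⟩ : ∃ m : ℝ, 0 ≤ m ∧ M ≤ Real.exp m ∧ DD + 1 ≤ Real.exp m := by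
    refine ⟨max M (DD + 1), by positivity, ?_, ?_⟩
    · linarith [Real.add_one_le_exp (max M (DD + 1)), le_max_left M (DD + 1)]
    · linarith [Real.add_one_le_exp (max M (DD + 1)), le_max_right M (DD + 1)]
  refine ⟨max (6 * (28 + m)) (12 * (26 + m) / c), le_max_of_le_left (by linarith), ?_⟩
  intro z hz U η hU1 hU2 hη1 hη2
  have hz1 : 6 * (28 + m) ≤ z := (le_max_left _ _).trans hz
  have hz2 : 12 * (26 + m) / c ≤ z := (le_max_right _ _).trans hz
  have hz3 : 168 ≤ z := by linarith
  have hη0 : 0 < η := (Real.exp_pos _).trans_le hη1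
  have hzz3 : 1 ≤ z ^ 3 := by
    have : (1:ℝ) ^ 3 ≤ z ^ 3 := by gcongr; linarith
    linarith
  have hU0 : 0 ≤ U := by linarith
  -- the growth facts
  have g1 : 2 * z ^ 3 + 16 * z + m + 10 ≤ Real.exp (2 * z) / 4 := by
    have := Real.pow_div_factorial_le_exp (2 * z) (by linarith) 4
    have e : (2 * z) ^ 4 / (Nat.factorial 4 : ℝ) = 2 * z ^ 4 / 3 := by
      simp [Nat.factorial]; ring
    rw [e] at this
    have hz4 : 6 * (28 + m) * z ^ 3 ≤ z ^ 4 := by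
      rw [show z ^ 4 = z * z ^ 3 by ring]; gcongr
    have hz5 : z ≤ z ^ 3 := le_self_pow₀ (by linarith) (by norm_num)
    have : m ≤ m * z ^ 3 := le_mul_of_one_le_right hm0 hzz3
    nlinarith
  have g2 : 21 * z + m + 5 ≤ c * z ^ 2 / 12 := by
    rw [div_le_iff₀ hc0] at hz2
    nlinarith
  set T : ℝ := Real.exp (5 * z) with hT
  have hT1 : 5 * z + 1 ≤ T := Real.add_one_le_exp _
  have hT3 : 3 ≤ T := by linarith
  have hlogT0 : 0 < Real.log (T + 1) := Real.log_pos (by linarith)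
  have hlogT : Real.log (T + 1) ≤ 6 * z := by
    rw [Real.log_le_iff_le_exp (by linarith)]
    have : Real.exp (6 * z) = T * Real.exp z := by rw [hT, ← Real.exp_add]; congr 1; ring
    rw [this]
    have := Real.add_one_le_exp z
    nlinarith
  have hlogT1 : 1 ≤ Real.log (T + 1) := by
    rw [Real.le_log_iff_exp_le (by linarith)]
    linarith [Real.exp_one_lt_d9]
  set δ : ℝ := c / Real.log (T + 1) / 2 with hδ
  have hδ0 : 0 < δ := by positivity
  have hδ1 : δ ≤ 1 := by
    rw [hδ, div_div, div_le_one (by positivity)]; linarith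
  have hδU : c * z ^ 2 / 12 ≤ δ * U := by
    have h1 : c / (6 * z) / 2 ≤ δ := by rw [hδ]; gcongr
    calc c * z ^ 2 / 12 = c / (6 * z) / 2 * z ^ 3 := by field_simp; ring
      _ ≤ δ * U := by gcongr
  set B : ℝ := 9216 * (T + 5) ^ 2 / (c / Real.log (T + 1)) ^ 3 with hB
  have hB1 : B ≤ Real.exp (m + 13 * z) := by
    have h1 : T + 5 ≤ 6 * T := by linarith
    have h2 : Real.log (T + 1) ≤ 6 * Real.exp z := by linarith [Real.add_one_le_exp z]
    calc B ≤ 9216 * (6 * T) ^ 2 / (c / (6 * Real.exp z)) ^ 3 := by rw [hB]; gcongr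
      _ = M * (T ^ 2 * Real.exp z ^ 3) := by rw [hM]; field_simp; ring
      _ ≤ Real.exp m * (T ^ 2 * Real.exp z ^ 3) := by gcongr
      _ = Real.exp (m + 13 * z) := by
        rw [hT, ← Real.exp_nat_mul, ← Real.exp_nat_mul, ← Real.exp_add, ← Real.exp_add]
        congr 1; push_cast; ring
  have hE := EE_total (U := U) (B := B) hη0 hη2 (by linarith : 0 < T) hδ0 hδ1 hU0 (hc T hT3)
  have hηT : Real.exp (2 * z) ≤ η ^ 2 * T ^ 2 := by
    have : Real.exp z ≤ η * T := by
      calc Real.exp z = Real.exp (-4 * z) * T := by rw [hT, ← Real.exp_add]; congr 1; ring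
        _ ≤ η * T := by gcongr
    calc Real.exp (2 * z) = Real.exp z ^ 2 := by rw [← Real.exp_nat_mul]; norm_num
      _ ≤ (η * T) ^ 2 := by gcongr
      _ = _ := by ring
  have he2 : (4:ℝ) ≤ Real.exp 2 := by
    have := Real.exp_one_gt_d9
    have e : Real.exp 2 = Real.exp 1 ^ 2 := by rw [← Real.exp_nat_mul]; norm_num
    rw [e]; nlinarith
  have t1 : 4 * (B * Real.exp (2 + U - η ^ 2 * T ^ 2 / 2)) ≤ Real.exp (-3 * z - 2) := by
    calc 4 * (B * Real.exp (2 + U - η ^ 2 * T ^ 2 / 2)) ≤ Real.exp 2 * (Real.exp (m + 13 * z) * Real.exp (2 + U - η ^ 2 * T ^ 2 / 2)) := by gcongr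
      _ = Real.exp (2 + (m + 13 * z + (2 + U - η ^ 2 * T ^ 2 / 2))) := by simp only [Real.exp_add]
      _ ≤ _ := by apply Real.exp_le_exp.mpr; linarith [Real.exp_pos (2 * z)]
  have t2 : 2 * T * (B * Real.exp (2 - δ * U)) ≤ Real.exp (-3 * z - 2) := by
    have he1 : (2:ℝ) ≤ Real.exp 1 := by linarith [Real.exp_one_gt_d9]
    calc 2 * T * (B * Real.exp (2 - δ * U)) ≤ Real.exp 1 * Real.exp (5 * z) * (Real.exp (m + 13 * z) * Real.exp (2 - δ * U)) := by gcongr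
      _ = Real.exp (1 + 5 * z + (m + 13 * z + (2 - δ * U))) := by simp only [Real.exp_add]
      _ ≤ _ := by apply Real.exp_le_exp.mpr; linarith
  have t3 : (DD + 1) * (Real.exp (2 + U - η ^ 2 * T ^ 2 / 4) * (4 / η)) ≤ Real.exp (-3 * z - 2) := by
    have h4 : 4 / η ≤ Real.exp 2 * Real.exp (4 * z) := by
      rw [div_le_iff₀ hη0]
      calc (4:ℝ) ≤ Real.exp 2 := he2
        _ = Real.exp 2 * Real.exp (4 * z) * Real.exp (-4 * z) := by
          rw [mul_assoc, ← Real.exp_add]; simp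
        _ ≤ _ := by gcongr
    calc (DD + 1) * (Real.exp (2 + U - η ^ 2 * T ^ 2 / 4) * (4 / η)) ≤
        Real.exp m * (Real.exp (2 + U - η ^ 2 * T ^ 2 / 4) * (Real.exp 2 * Real.exp (4 * z))) := by gcongr
      _ = Real.exp (m + (2 + U - η ^ 2 * T ^ 2 / 4 + (2 + 4 * z))) := by simp only [Real.exp_add]
      _ ≤ _ := by apply Real.exp_le_exp.mpr; linarith
  have t4 : Real.sqrt 2 * Real.exp (-U ^ 2 / (4 * η ^ 2)) ≤ Real.exp (-3 * z - 2) := by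
    have h1 : Real.sqrt 2 ≤ Real.exp 1 := by
      have : Real.sqrt 2 ≤ 2 := by rw [Real.sqrt_le_left (by norm_num)]; norm_num
      linarith [Real.exp_one_gt_d9]
    have h2 : U / 16 ≤ U ^ 2 / (4 * η ^ 2) := by
      rw [div_le_div_iff₀ (by norm_num) (by positivity)]
      have : η ^ 2 ≤ 2 ^ 2 := by gcongr
      have hU2' : U ≤ U ^ 2 := le_self_pow₀ (by linarith) (by norm_num)
      calc U * (4 * η ^ 2) ≤ U ^ 2 * (4 * 2 ^ 2) := by gcongr
        _ = U ^ 2 * 16 := by norm_num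
    have h3 : 168 * 168 * z ≤ z ^ 3 := by
      rw [show z ^ 3 = z * z * z by ring]; gcongr
    calc Real.sqrt 2 * Real.exp (-U ^ 2 / (4 * η ^ 2)) ≤ Real.exp 1 * Real.exp (-U ^ 2 / (4 * η ^ 2)) := by gcongr
      _ = Real.exp (1 + -U ^ 2 / (4 * η ^ 2)) := by rw [Real.exp_add]
      _ ≤ _ := by
        apply Real.exp_le_exp.mpr
        rw [neg_div]
        linarith
  have hs := vm_error hη0 U
  refine ⟨hs.summable, ?_⟩
  rw [hs.tsum_eq]
  obtain ⟨k1, k2⟩ := gs_half hη0 hU0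
  set J := ∫ t : ℝ, deriv ZZ (2 + t * Complex.I) / ZZ (2 + t * Complex.I) * KK η U (1 + t * Complex.I)
  set G := ∫ v in Set.Ioi (0:ℝ), gs η (U - v)
  have hJ : |J.re| ≤ 3 * Real.exp (-3 * z - 2) := (Complex.abs_re_le_norm J).trans (by linarith)
  have hpi : 1 / (2 * Real.pi) ≤ 1 := by
    rw [div_le_one (by positivity)]; linarith [Real.pi_gt_three]
  have hpi0 : 0 ≤ 1 / (2 * Real.pi) := by positivity
  have hJ2 : |1 / (2 * Real.pi) * J.re| ≤ 3 * Real.exp (-3 * z - 2) := by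
    rw [abs_mul, abs_of_nonneg hpi0]
    exact (mul_le_of_le_one_left (abs_nonneg _) hpi).trans hJ
  have hfin : 4 * Real.exp (-3 * z - 2) ≤ Real.exp (-3 * z) := by
    calc 4 * Real.exp (-3 * z - 2) ≤ Real.exp 2 * Real.exp (-3 * z - 2) := by gcongr
      _ = _ := by rw [← Real.exp_add]; congr 1; ring
  rw [abs_le] at hJ2 ⊢
  constructor <;> linarith [hJ2.1, hJ2.2, Real.exp_pos (-3 * z - 2)]

open ArithmeticFunction in
theorem smooth_point : ∃ z0 : ℝ, 1 ≤ z0 ∧ ∀ z : ℝ, z0 ≤ z → ∀ (b η L : ℝ) (S : Finset ℕ), 1 ≤ b → η = Real.exp (-4 * z) →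
    L = z ^ 3 → (∀ n : ℕ, n ∈ S ↔ Real.exp L ≤ n ∧ (n:ℝ) < Real.exp (L + L / b)) →
    ∀ U : ℝ, L + η * L ≤ U → U ≤ L + L / b - η * L →
    (1 - Real.exp (-3 * z)) * U⁻¹ ≤
      ∑ n ∈ S, vonMangoldt n / (n * (Real.log n - η * L)) * gs η (U - Real.log n) + 4 * Real.exp (-L ^ 2 / 4) := by
  obtain ⟨z0, h0, hz0⟩ := gauss_pnt
  refine ⟨z0, h0, ?_⟩
  intro z hz b η L S hb hη hL hS U hU1 hU2
  have hz1 : 1 ≤ z := h0.trans hz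
  have hη0 : 0 < η := by rw [hη]; exact Real.exp_pos _
  have hη1 : η < 1 := by rw [hη]; apply Real.exp_lt_one_iff.mpr; linarith
  have hL1 : 1 ≤ L := by rw [hL]; exact one_le_pow₀ hz1
  have hε : 0 < η * L := by positivity
  have hε1 : η * L < L := by nlinarith
  have hLb : L / b ≤ L := div_le_self (by linarith) hb
  have hU0 : 1 ≤ U := by linarith
  have hs2 : Real.sqrt 2 ≤ 2 := by rw [Real.sqrt_le_left (by norm_num)]; norm_num
  have hs1 : 1 ≤ Real.sqrt 2 := by rw [Real.one_le_sqrt]; norm_num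
  obtain ⟨w1, w2⟩ := hz0 z hz U η (by linarith) (by linarith) hη.ge (by linarith)
  obtain ⟨v1, v2⟩ := hz0 z hz U (Real.sqrt 2 * η) (by linarith) (by linarith) (by nlinarith) (by nlinarith)
  set τ : ℝ := Real.sqrt 2 * Real.exp (-L ^ 2 / 4) with hτ
  set g : ℕ → ℝ := fun n => vonMangoldt n / (n * (Real.log n - η * L)) * gs η (U - Real.log n) with hg
  have hgpos : ∀ n ∈ S, 0 ≤ g n := by
    intro n hn
    rw [hS] at hn
    have : L ≤ Real.log n := by
      rw [Real.le_log_iff_exp_le ((Real.exp_pos _).trans_le hn.1)]; exact hn.1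
    have h1 : 0 ≤ Real.log n - η * L := by linarith
    exact mul_nonneg (div_nonneg vonMangoldt_nonneg (by positivity)) (gs_nonneg hη0 _)
  have hpt : ∀ n : ℕ, vonMangoldt n / n * gs η (U - Real.log n) * U⁻¹ ≤
      (if n ∈ S then g n else 0) + τ * (vonMangoldt n / n * gs (Real.sqrt 2 * η) (U - Real.log n)) := by
    intro n
    have hΛ : 0 ≤ vonMangoldt n / n := div_nonneg vonMangoldt_nonneg (by positivity)
    have hB : 0 ≤ τ * (vonMangoldt n / n * gs (Real.sqrt 2 * η) (U - Real.log n)) :=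
      mul_nonneg (by positivity) (mul_nonneg hΛ (gs_nonneg (by positivity) _))
    by_cases hlt : |U - Real.log n| < η * L
    · rcases Nat.eq_zero_or_pos n with rfl | hn
      · simp only [CharP.cast_eq_zero, Real.log_zero, sub_zero] at hlt
        rw [abs_lt] at hlt
        linarith [hlt.2]
      have hnr : (0:ℝ) < n := by exact_mod_cast hn
      rw [abs_lt] at hlt
      have hmem : n ∈ S := by
        rw [hS, ← Real.le_log_iff_exp_le hnr, ← Real.log_lt_iff_lt_exp hnr]
        constructor <;> linarith [hlt.1, hlt.2]
      rw [if_pos hmem]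
      have h1 : L ≤ Real.log n := by linarith [hlt.2]
      have h2 : U⁻¹ ≤ (Real.log n - η * L)⁻¹ := by
        apply inv_anti₀ <;> linarith [hlt.1]
      have : vonMangoldt n / n * gs η (U - Real.log n) * U⁻¹ ≤ g n := by
        calc vonMangoldt n / n * gs η (U - Real.log n) * U⁻¹ ≤
            vonMangoldt n / n * gs η (U - Real.log n) * (Real.log n - η * L)⁻¹ :=
              mul_le_mul_of_nonneg_left h2 (mul_nonneg hΛ (gs_nonneg hη0 _))
          _ = g n := by
            simp only [hg, div_eq_mul_inv, mul_inv]; ring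
      linarith
    · push Not at hlt
      have h1 := gs_tail hη0 hε.le hlt
      have e : -(η * L) ^ 2 / (4 * η ^ 2) = -L ^ 2 / 4 := by field_simp
      rw [e] at h1
      have h2 : 0 ≤ if n ∈ S then g n else 0 := by
        split_ifs with h
        · exact hgpos n h
        · exact le_rfl
      have h3 : U⁻¹ ≤ 1 := inv_le_one_of_one_le₀ hU0
      have h4 : 0 ≤ vonMangoldt n / n * gs η (U - Real.log n) := mul_nonneg hΛ (gs_nonneg hη0 _)
      calc _ ≤ vonMangoldt n / n * gs η (U - Real.log n) := mul_le_of_le_one_right h4 h3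
        _ ≤ vonMangoldt n / n * (τ * gs (Real.sqrt 2 * η) (U - Real.log n)) := mul_le_mul_of_nonneg_left h1 hΛ
        _ = τ * (vonMangoldt n / n * gs (Real.sqrt 2 * η) (U - Real.log n)) := by ring
        _ ≤ _ := by linarith
  have hsum1 : HasSum (fun n => if n ∈ S then g n else 0) (∑ n ∈ S, g n) := by
    have h1 : HasSum (fun n => if n ∈ S then g n else 0) (∑ n ∈ S, if n ∈ S then g n else 0) :=
      hasSum_sum_of_ne_finset_zero (by intro n hn; simp [hn])
    have h2 : (∑ n ∈ S, if n ∈ S then g n else 0) = ∑ n ∈ S, g n :=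
      Finset.sum_congr rfl fun n hn => by simp [hn]
    rwa [h2] at h1
  have htot := hasSum_le hpt (w1.hasSum.mul_right U⁻¹) (hsum1.add (v1.hasSum.mul_left τ))
  rw [abs_le] at w2 v2
  have he : Real.exp (-3 * z) ≤ 1 := by apply Real.exp_le_one_iff.mpr; linarith
  have hUi : 0 < U⁻¹ := by positivity
  have hτ0 : 0 ≤ τ := by positivity
  have hτ1 : τ ≤ 2 * Real.exp (-L ^ 2 / 4) := by rw [hτ]; gcongr
  set W := ∑' n : ℕ, vonMangoldt n / n * gs η (U - Real.log n)
  set V := ∑' n : ℕ, vonMangoldt n / n * gs (Real.sqrt 2 * η) (U - Real.log n)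
  have q1 : (1 - Real.exp (-3 * z)) * U⁻¹ ≤ W * U⁻¹ := by gcongr; linarith [w2.1]
  have q2 : τ * V ≤ τ * 2 := by gcongr; linarith [v2.2]
  linarith

open ArithmeticFunction in
theorem smooth_lower : ∃ z0 : ℝ, 1 ≤ z0 ∧ ∀ z : ℝ, z0 ≤ z → ∀ (b η L : ℝ) (S : Finset ℕ), 1 ≤ b → η = Real.exp (-4 * z) →
    L = z ^ 3 → 2 * η ≤ 1 / b → (∀ n : ℕ, n ∈ S ↔ Real.exp L ≤ n ∧ (n:ℝ) < Real.exp (L + L / b)) →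
    (1 - Real.exp (-3 * z)) * Real.log ((L + L / b - η * L) / (L + η * L)) - 4 * Real.exp (-L ^ 2 / 4) * L ≤
      (1 - η)⁻¹ * ∑ n ∈ S, vonMangoldt n / (n * Real.log n) := by
  obtain ⟨z0, h0, hz0⟩ := smooth_point
  refine ⟨z0, h0, ?_⟩
  intro z hz b η L S hb hη hL hηb hS
  have hp := hz0 z hz b η L S hb hη hL hS
  have hz1 : 1 ≤ z := h0.trans hz
  have hη0 : 0 < η := by rw [hη]; exact Real.exp_pos _
  have hη1 : η < 1 := by rw [hη]; apply Real.exp_lt_one_iff.mpr; linarith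
  have hL1 : 1 ≤ L := by rw [hL]; exact one_le_pow₀ hz1
  have hε : 0 < η * L := by positivity
  have hε1 : η * L < L := by nlinarith
  have hLb : L / b ≤ L := div_le_self (by linarith) hb
  set A := L + η * L with hA
  set B := L + L / b - η * L with hB
  have hAB : A ≤ B := by
    have : 2 * η * L ≤ 1 / b * L := by gcongr
    rw [one_div_mul_eq_div] at this
    linarith
  have hA0 : 0 < A := by linarith
  have hlogS : ∀ n ∈ S, L ≤ Real.log n ∧ (0:ℝ) < n := by
    intro n hn
    rw [hS] at hn
    have hn0 : (0:ℝ) < n := (Real.exp_pos _).trans_le hn.1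
    exact ⟨by rw [Real.le_log_iff_exp_le hn0]; exact hn.1, hn0⟩
  have hcU : ∀ n : ℕ, Continuous fun U => gs η (U - Real.log n) := fun n => gs_cont.comp (by fun_prop)
  have hmono := intervalIntegral.integral_mono_on (μ := MeasureTheory.volume) hAB
    (f := fun U => (1 - Real.exp (-3 * z)) * U⁻¹)
    (g := fun U => ∑ n ∈ S, vonMangoldt n / (n * (Real.log n - η * L)) * gs η (U - Real.log n) + 4 * Real.exp (-L ^ 2 / 4))
    (by
      apply ContinuousOn.intervalIntegrable
      apply ContinuousOn.mul continuousOn_const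
      apply continuousOn_inv₀.mono
      intro x hx
      rw [Set.uIcc_of_le hAB] at hx
      simp; linarith [hx.1])
    (by
      apply Continuous.intervalIntegrable
      refine Continuous.add (continuous_finsetSum _ fun n _ => ?_) continuous_const
      exact continuous_const.mul (hcU n))
    (fun U hU => hp U hU.1 hU.2)
  rw [intervalIntegral.integral_const_mul, integral_inv (by rw [Set.uIcc_of_le hAB]; intro h; linarith [h.1]),
    intervalIntegral.integral_add (by
      apply Continuous.intervalIntegrable
      exact continuous_finsetSum _ fun n _ => continuous_const.mul (hcU n)) (by simp),
    intervalIntegral.integral_finsetSum (fun n _ => Continuous.intervalIntegrable (by have := hcU n; fun_prop) _ _),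
    intervalIntegral.integral_const, smul_eq_mul] at hmono
  simp_rw [intervalIntegral.integral_const_mul] at hmono
  have hIntg : ∀ n : ℕ, ∫ U in A..B, gs η (U - Real.log n) ≤ 1 := by
    intro n
    rw [intervalIntegral.integral_of_le hAB]
    refine (MeasureTheory.setIntegral_le_integral ((gs_integrable hη0).comp_sub_right _)
      (Eventually.of_forall fun v => gs_nonneg hη0 _)).trans ?_
    rw [MeasureTheory.integral_sub_right_eq_self (gs η), gs_integral hη0]
  have hsum : ∑ n ∈ S, vonMangoldt n / (n * (Real.log n - η * L)) * (∫ U in A..B, gs η (U - Real.log n)) ≤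
      (1 - η)⁻¹ * ∑ n ∈ S, vonMangoldt n / (n * Real.log n) := by
    rw [Finset.mul_sum]
    refine Finset.sum_le_sum fun n hn => ?_
    obtain ⟨h1, h2⟩ := hlogS n hn
    have h3 : 0 < Real.log n - η * L := by linarith
    have h4 : 0 ≤ vonMangoldt n / (n * (Real.log n - η * L)) := div_nonneg vonMangoldt_nonneg (by positivity)
    refine (mul_le_of_le_one_right h4 (hIntg n)).trans ?_
    have h5 : 0 < Real.log n := by linarith
    have h6 : 0 < 1 - η := by linarith
    have e : (1 - η)⁻¹ * (vonMangoldt n / (n * Real.log n)) = vonMangoldt n / (n * ((1 - η) * Real.log n)) := by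
      field_simp
    rw [e]
    apply div_le_div_of_nonneg_left vonMangoldt_nonneg (by positivity)
    gcongr
    nlinarith
  have hBA : (B - A) * (4 * Real.exp (-L ^ 2 / 4)) ≤ 4 * Real.exp (-L ^ 2 / 4) * L := by
    rw [mul_comm]
    gcongr
    linarith
  linarith

theorem pp_bound : ∃ C : ℝ, 0 ≤ C ∧ (∀ S : Finset ℕ, ∑ n ∈ S with (IsPrimePow n ∧ ¬ n.Prime), (n:ℝ) ^ (-(3/4) : ℝ) ≤ C) ∧
    ∀ S : Finset ℕ, ∑ n ∈ S, (n:ℝ) ^ (-(3/2) : ℝ) ≤ C := by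
  set r : ℝ := (2:ℝ) ^ (-(3/4) : ℝ) with hr
  have hr0 : 0 < r := by positivity
  have hr1 : r < 1 := Real.rpow_lt_one_of_one_lt_of_neg (by norm_num) (by norm_num)
  have s1 : Summable fun n : ℕ => (n:ℝ) ^ (-(3/2) : ℝ) := by
    rw [Real.summable_nat_rpow]; norm_num
  have s2 : Summable fun k : ℕ => r ^ k := summable_geometric_of_lt_one hr0.le hr1
  set C1 := ∑' n : ℕ, (n:ℝ) ^ (-(3/2) : ℝ)
  set C2 := ∑' k : ℕ, r ^ k
  have hC1 : ∀ S : Finset ℕ, ∑ n ∈ S, (n:ℝ) ^ (-(3/2) : ℝ) ≤ C1 := fun S =>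
    s1.sum_le_tsum S fun n _ => by positivity
  have hC2 : ∀ S : Finset ℕ, ∑ n ∈ S, r ^ n ≤ C2 := fun S =>
    s2.sum_le_tsum S fun n _ => by positivity
  have hC10 : 0 ≤ C1 := by simpa using hC1 ∅
  have hC20 : 0 ≤ C2 := by simpa using hC2 ∅
  refine ⟨max (C1 * C2) C1, le_max_of_le_right hC10, fun S => ?_, fun S => (hC1 S).trans (le_max_right _ _)⟩
  refine le_trans ?_ (le_max_left _ _)
  set F := S.filter (fun n => IsPrimePow n ∧ ¬ n.Prime) with hF
  have hex : ∀ n : ℕ, ∃ q : ℕ × ℕ, n ∈ F → q.1.Prime ∧ n = q.1 ^ (q.2 + 2) := by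
    intro n
    by_cases hn : n ∈ F
    · obtain ⟨_, hpp, hnp⟩ := Finset.mem_filter.mp hn
      obtain ⟨p, k, hp, hk, h⟩ := (isPrimePow_nat_iff n).mp hpp
      have hk1 : k ≠ 1 := by
        rintro rfl
        rw [pow_one] at h
        exact hnp (h ▸ hp)
      obtain ⟨j, rfl⟩ : ∃ j, k = j + 2 := ⟨k - 2, by omega⟩
      exact ⟨(p, j), fun _ => ⟨hp, h.symm⟩⟩
    · exact ⟨(0, 0), fun h => absurd h hn⟩
  choose q hq using hex
  have hinj : Set.InjOn q F := by
    intro x hx y hy h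
    rw [(hq x hx).2, (hq y hy).2, h]
  calc ∑ n ∈ F, (n:ℝ) ^ (-(3/4) : ℝ) ≤ ∑ n ∈ F, (((q n).1 : ℝ) ^ (-(3/2) : ℝ) * r ^ (q n).2) := by
        refine Finset.sum_le_sum fun n hn => ?_
        obtain ⟨hp, h⟩ := hq n hn
        have hp2 : (2:ℝ) ≤ (q n).1 := by exact_mod_cast hp.two_le
        have hp0 : (0:ℝ) < (q n).1 := by linarith
        have e : (n:ℝ) ^ (-(3/4) : ℝ) = ((q n).1 : ℝ) ^ (-(3/2) : ℝ) * (((q n).1 : ℝ) ^ (-(3/4) : ℝ)) ^ (q n).2 := by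
          conv_lhs => rw [h]
          push_cast
          rw [← Real.rpow_natCast, ← Real.rpow_mul hp0.le, ← Real.rpow_natCast (_ ^ _), ← Real.rpow_mul hp0.le,
            ← Real.rpow_add hp0]
          congr 1
          push_cast; ring
        rw [e]
        gcongr
        rw [hr]
        exact Real.rpow_le_rpow_of_nonpos (by norm_num) hp2 (by norm_num)
    _ = ∑ x ∈ F.image q, ((x.1 : ℝ) ^ (-(3/2) : ℝ) * r ^ x.2) := by
        rw [Finset.sum_image hinj]
    _ ≤ ∑ x ∈ ((F.image q).image Prod.fst) ×ˢ ((F.image q).image Prod.snd), ((x.1 : ℝ) ^ (-(3/2) : ℝ) * r ^ x.2) := by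
        apply Finset.sum_le_sum_of_subset_of_nonneg
        · exact Finset.subset_product
        · intro x _ _; positivity
    _ = (∑ p ∈ (F.image q).image Prod.fst, (p : ℝ) ^ (-(3/2) : ℝ)) * ∑ k ∈ (F.image q).image Prod.snd, r ^ k := by
        rw [Finset.sum_mul_sum, Finset.sum_product]
    _ ≤ C1 * C2 := by
        gcongr
        · exact hC1 _
        · exact hC2 _

open ArithmeticFunction in
theorem primes_lower : ∃ C : ℝ, 0 ≤ C ∧ ∀ (L : ℝ) (S : Finset ℕ), 1 ≤ L → (∀ n ∈ S, Real.exp L ≤ n) →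
    ∑ n ∈ S, vonMangoldt n / (n * Real.log n) - C * Real.exp (-L / 4) ≤ ∑ p ∈ S with p.Prime, Real.log (1 + 1 / (p:ℝ)) := by
  obtain ⟨C, hC, h1, h2⟩ := pp_bound
  refine ⟨2 * C, by positivity, ?_⟩
  intro L S hL hS
  have hpt : ∀ n ∈ S, vonMangoldt n / (n * Real.log n) ≤ (if n.Prime then Real.log (1 + 1 / (n:ℝ)) else 0)
      + Real.exp (-L / 4) * (n:ℝ) ^ (-(3/2) : ℝ) +
      Real.exp (-L / 4) * (if (IsPrimePow n ∧ ¬ n.Prime) then (n:ℝ) ^ (-(3/4) : ℝ) else 0) := by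
    intro n hn
    have hnL := hS n hn
    have hn0 : (0:ℝ) < n := (Real.exp_pos _).trans_le hnL
    have hlog : L ≤ Real.log n := by rw [Real.le_log_iff_exp_le hn0]; exact hnL
    have hlog0 : 0 < Real.log n := by linarith
    have hq : ∀ x : ℝ, 1/4 ≤ x → (n:ℝ) ^ (-x) ≤ Real.exp (-L / 4) := by
      intro x hx
      rw [Real.rpow_def_of_pos hn0]
      apply Real.exp_le_exp.mpr
      nlinarith
    by_cases hp : n.Prime
    · rw [if_pos hp, if_neg (by tauto), vonMangoldt_apply_prime hp, mul_zero, add_zero]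
      have e1 : Real.log n / (n * Real.log n) = 1 / n := by field_simp
      rw [e1]
      have e2 := Real.one_sub_inv_le_log_of_pos (show (0:ℝ) < 1 + 1 / n by positivity)
      have e3 : 1 / (n:ℝ) - (1 - (1 + 1 / (n:ℝ))⁻¹) ≤ (n:ℝ) ^ (-2 : ℝ) := by
        rw [Real.rpow_neg hn0.le, Real.rpow_two]
        have : 1 / (n:ℝ) - (1 - (1 + 1 / (n:ℝ))⁻¹) = (n * (n + 1) : ℝ)⁻¹ := by
          field_simp
          ring
        rw [this]
        apply inv_anti₀ (by positivity)
        nlinarith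
      have e4 : (n:ℝ) ^ (-2 : ℝ) ≤ Real.exp (-L / 4) * (n:ℝ) ^ (-(3/2) : ℝ) := by
        calc (n:ℝ) ^ (-2 : ℝ) = (n:ℝ) ^ (-(1/2) : ℝ) * (n:ℝ) ^ (-(3/2) : ℝ) := by
              rw [← Real.rpow_add hn0]; norm_num
          _ ≤ _ := by
              gcongr
              exact hq _ (by norm_num)
      linarith
    · rw [if_neg hp]
      by_cases hpp : IsPrimePow n
      · rw [if_pos ⟨hpp, hp⟩]
        have e1 : vonMangoldt n / (n * Real.log n) ≤ (n:ℝ) ^ (-1 : ℝ) := by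
          rw [Real.rpow_neg_one, div_le_iff₀ (by positivity)]
          have := vonMangoldt_le_log (n := n)
          calc vonMangoldt n ≤ Real.log n := this
            _ = (n:ℝ)⁻¹ * (n * Real.log n) := by field_simp
        have e4 : (n:ℝ) ^ (-1 : ℝ) ≤ Real.exp (-L / 4) * (n:ℝ) ^ (-(3/4) : ℝ) := by
          calc (n:ℝ) ^ (-1 : ℝ) = (n:ℝ) ^ (-(1/4) : ℝ) * (n:ℝ) ^ (-(3/4) : ℝ) := by
                rw [← Real.rpow_add hn0]; norm_num
            _ ≤ _ := by
                gcongr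
                exact hq _ (by norm_num)
        have : 0 ≤ Real.exp (-L / 4) * (n:ℝ) ^ (-(3/2) : ℝ) := by positivity
        linarith
      · rw [if_neg (by tauto), vonMangoldt_eq_zero_iff.mpr hpp, zero_div]
        positivity
  have hs := Finset.sum_le_sum hpt
  rw [Finset.sum_add_distrib, Finset.sum_add_distrib, ← Finset.mul_sum, ← Finset.mul_sum, ← Finset.sum_filter,
    ← Finset.sum_filter] at hs
  have q1 : Real.exp (-L / 4) * ∑ n ∈ S, (n:ℝ) ^ (-(3/2) : ℝ) ≤ Real.exp (-L / 4) * C := by gcongr; exact h2 S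
  have q2 : Real.exp (-L / 4) * ∑ n ∈ S with (IsPrimePow n ∧ ¬ n.Prime), (n:ℝ) ^ (-(3/4) : ℝ) ≤ Real.exp (-L / 4) * C := by
    gcongr; exact h1 S
  linarith

set_option maxHeartbeats 1000000 in
theorem sum_lower : ∃ z1 : ℝ, 1 ≤ z1 ∧ ∀ z : ℝ, z1 ≤ z → ∀ (b L : ℝ) (S : Finset ℕ), 1 ≤ b → b + 2 ≤ Real.exp z →
    L = z ^ 3 → (∀ n : ℕ, n ∈ S ↔ Real.exp L ≤ n ∧ (n:ℝ) < Real.exp (L + L / b)) →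
    Real.log ((b + 2) / (b + 1)) ≤ ∑ p ∈ S with p.Prime, Real.log (1 + 1 / (p:ℝ)) := by
  obtain ⟨z0, h0, hz0⟩ := smooth_lower
  obtain ⟨C, hC0, hC⟩ := primes_lower
  refine ⟨max z0 (4 + C), h0.trans (le_max_left _ _), ?_⟩
  intro z hz b L S hb hbz hL hS
  have hz1 : z0 ≤ z := (le_max_left _ _).trans hz
  have hz2 : 4 + C ≤ z := (le_max_right _ _).trans hz
  have hz4 : 4 ≤ z := by linarith
  have hzz : 16 * z ≤ L := by rw [hL]; nlinarith [mul_nonneg (by linarith : 0 ≤ z) (by nlinarith : 0 ≤ z ^ 2 - 16)]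
  have hez : 5 ≤ Real.exp z := by linarith [Real.add_one_le_exp z]
  set x : ℝ := Real.exp (-z) with hx
  have hx0 : 0 < x := Real.exp_pos _
  have hxz : x * Real.exp z = 1 := by rw [hx, ← Real.exp_add]; simp
  have hx5 : x ≤ 1 / 5 := by nlinarith
  have hx2 : Real.exp (-2 * z) = x ^ 2 := by rw [hx, ← Real.exp_nat_mul]; congr 1; push_cast; ring
  have hx3 : Real.exp (-3 * z) = x ^ 3 := by rw [hx, ← Real.exp_nat_mul]; congr 1; push_cast; ring
  have hx4 : Real.exp (-4 * z) = x ^ 4 := by rw [hx, ← Real.exp_nat_mul]; congr 1; push_cast; ring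
  set η : ℝ := x ^ 4 with hη
  have hη0 : 0 < η := by positivity
  have hxx2 : x ^ 2 ≤ 1 / 25 := by nlinarith
  have hηx : η ≤ x ^ 2 / 25 := by rw [hη]; nlinarith [sq_nonneg x]
  have hx3' : x ^ 3 ≤ x ^ 2 / 5 := by nlinarith [sq_nonneg x]
  have hbx : x * (b + 2) ≤ 1 := by rw [← hxz]; gcongr
  have hηb : 2 * η ≤ 1 / b := by
    rw [le_div_iff₀ (by linarith)]
    have : x * b ≤ 1 := by nlinarith
    have h3 : x ^ 3 ≤ 1 / 2 := by nlinarith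
    calc 2 * η * b = 2 * x ^ 3 * (x * b) := by rw [hη]; ring
      _ ≤ 2 * (1 / 2) * 1 := by gcongr
      _ = 1 := by norm_num
  have hA := hz0 z hz1 b η L S hb hx4.symm hL hηb hS
  have hP := hC L S (by linarith) (fun n hn => ((hS n).mp hn).1)
  set SS := ∑ n ∈ S, ArithmeticFunction.vonMangoldt n / (n * Real.log n)
  set P := ∑ p ∈ S with p.Prime, Real.log (1 + 1 / (p:ℝ))
  have hL0 : 0 < L := by linarith
  set β : ℝ := 1 + 1 / b with hβ
  have hβ1 : 1 ≤ β := by rw [hβ]; have : 0 < 1 / b := by positivity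
                         linarith
  have hβ2 : β ≤ 2 := by
    have : 1 / b ≤ 1 := by rw [div_le_one (by linarith)]; exact hb
    linarith
  have hη25 : η ≤ 1 / 625 := by linarith
  have eBA : (L + L / b - η * L) / (L + η * L) = (β - η) / (1 + η) := by
    rw [show L + L / b - η * L = (β - η) * L by rw [hβ]; ring, show L + η * L = (1 + η) * L by ring,
      mul_div_mul_right _ _ hL0.ne']
  rw [eBA, hx3] at hA
  set Q := Real.log ((β - η) / (1 + η)) with hQ
  have hβη : 0 < β - η := by linarith
  have hQ1 : Q ≤ 1 := by
    have h1 := Real.log_le_sub_one_of_pos (show 0 < (β - η) / (1 + η) by positivity)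
    have h2 : (β - η) / (1 + η) ≤ 2 := by rw [div_le_iff₀ (by linarith)]; linarith
    linarith
  have hQ0 : Real.log β - 3 * η ≤ Q := by
    have h1 := Real.one_sub_inv_le_log_of_pos (show 0 < ((β - η) / (1 + η)) / β by positivity)
    rw [Real.log_div (by positivity) (by positivity)] at h1
    have h2 : 1 - (((β - η) / (1 + η)) / β)⁻¹ = - (η * (1 + β) / (β - η)) := by
      field_simp
      ring
    have h3 : η * (1 + β) / (β - η) ≤ 3 * η := by
      rw [div_le_iff₀ hβη]; nlinarith
    linarith
  have hQpos : 0 ≤ Q := by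
    apply Real.log_nonneg
    rw [one_le_div (by linarith)]
    linarith
  -- small errors
  have he3 : (16:ℝ) ≤ Real.exp 3 := by
    have e : Real.exp 3 = Real.exp 1 ^ 3 := by rw [← Real.exp_nat_mul]; norm_num
    rw [e]
    have h1 := Real.exp_one_gt_d9
    calc (16:ℝ) ≤ 2.7 ^ 3 := by norm_num
      _ ≤ _ := by gcongr; linarith
  have hR : 4 * Real.exp (-L ^ 2 / 4) * L ≤ x ^ 2 / 4 := by
    have h1 : L ≤ Real.exp L := by linarith [Real.add_one_le_exp L]
    have h2 : 16 * Real.exp (-L ^ 2 / 4) * L ≤ x ^ 2 := by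
      calc 16 * Real.exp (-L ^ 2 / 4) * L ≤ Real.exp 3 * Real.exp (-L ^ 2 / 4) * Real.exp L := by gcongr
        _ = Real.exp (3 + -L ^ 2 / 4 + L) := by simp only [Real.exp_add]
        _ ≤ Real.exp (-2 * z) := by
          apply Real.exp_le_exp.mpr
          have h64 : 64 * L ≤ L ^ 2 := by
            rw [pow_two]; gcongr; linarith
          linarith
        _ = x ^ 2 := hx2
    linarith
  have hCe : C * Real.exp (-L / 4) ≤ x ^ 2 / 4 := by
    have h1 : C ≤ Real.exp C := by linarith [Real.add_one_le_exp C]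
    have h2 : 16 * (C * Real.exp (-L / 4)) ≤ x ^ 2 := by
      calc 16 * (C * Real.exp (-L / 4)) ≤ Real.exp 3 * (Real.exp C * Real.exp (-L / 4)) := by gcongr
        _ = Real.exp (3 + (C + -L / 4)) := by simp only [Real.exp_add]
        _ ≤ Real.exp (-2 * z) := by
          apply Real.exp_le_exp.mpr
          linarith
        _ = x ^ 2 := hx2
    have : 0 ≤ C * Real.exp (-L / 4) := by positivity
    linarith
  -- combine
  have hR0 : 0 ≤ 4 * Real.exp (-L ^ 2 / 4) * L := by positivity
  set R := 4 * Real.exp (-L ^ 2 / 4) * L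
  have hSS : (1 - η) * ((1 - x ^ 3) * Q - R) ≤ SS := by
    have h1 : 0 < 1 - η := by linarith
    calc (1 - η) * ((1 - x ^ 3) * Q - R) ≤ (1 - η) * ((1 - η)⁻¹ * SS) := by gcongr
      _ = SS := by field_simp
  have hx30 : 0 ≤ x ^ 3 := by positivity
  have hSS2 : Q - η - x ^ 3 - R ≤ SS := by
    refine le_trans ?_ hSS
    have k1 : η * Q ≤ η := mul_le_of_le_one_right hη0.le hQ1
    have k2 : x ^ 3 * Q ≤ x ^ 3 := mul_le_of_le_one_right hx30 hQ1
    have k3 : 0 ≤ η * (x ^ 3 * Q) := by positivity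
    have k4 : 0 ≤ η * R := by positivity
    nlinarith
  have hslack : Real.log ((b + 2) / (b + 1)) + x ^ 2 ≤ Real.log β := by
    have h1 := Real.one_sub_inv_le_log_of_pos (show 0 < β / ((b + 2) / (b + 1)) by positivity)
    rw [Real.log_div (by positivity) (by positivity)] at h1
    have h2 : 1 - (β / ((b + 2) / (b + 1)))⁻¹ = (1 / (b + 1)) ^ 2 := by
      rw [hβ]
      field_simp
      ring
    have h3 : x ≤ 1 / (b + 1) := by rw [le_div_iff₀ (by linarith)]; linarith
    have h4 : x ^ 2 ≤ (1 / (b + 1)) ^ 2 := by gcongr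
    linarith
  linarith

theorem final_aux : ∃ y₀ : ℝ, ∀ y : ℝ, y₀ ≤ y → ∀ a : ℤ, 3 ≤ a →
      (a : ℝ) ≤ Real.exp (Real.log y ^ ((1:ℝ)/3)) →
      ∀ lam : ℝ, 1 < lam → y ≤ lam ^ (a - 2) →
      1 / (a : ℝ)
        ≤ 1 - ∏ᶠ p ∈ {p : ℕ | p.Prime ∧ lam ^ (a - 2) ≤ (p : ℝ) ∧ (p : ℝ) < lam ^ (a - 1)},
            ((p : ℝ) / ((p : ℝ) + 1)) := by
  obtain ⟨z1, hz1, H⟩ := sum_lower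
  refine ⟨Real.exp (z1 ^ 3), ?_⟩
  intro y hy a ha hay lam hlam hyl
  have hlam0 : 0 < lam := by linarith
  set b : ℝ := a - 2 with hb
  have haR : (3:ℝ) ≤ a := by exact_mod_cast ha
  have hb1 : 1 ≤ b := by linarith
  set L : ℝ := b * Real.log lam with hL
  have hy0 : 0 < y := (Real.exp_pos _).trans_le hy
  have hXL : lam ^ (a - 2) = Real.exp L := by
    rw [← Real.rpow_intCast, Real.rpow_def_of_pos hlam0, hL, hb]
    congr 1; push_cast; ring
  have hXL2 : lam ^ (a - 1) = Real.exp (L + L / b) := by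
    rw [← Real.rpow_intCast, Real.rpow_def_of_pos hlam0]
    congr 1
    have : L / b = Real.log lam := by rw [hL]; field_simp
    rw [this, hL, hb]; push_cast; ring
  rw [hXL, hXL2]
  rw [hXL] at hyl
  have hlogy : z1 ^ 3 ≤ Real.log y := by rw [Real.le_log_iff_exp_le hy0]; exact hy
  have hlogL : Real.log y ≤ L := by rw [Real.log_le_iff_le_exp hy0]; exact hyl
  have hz10 : 0 ≤ z1 := by linarith
  have hz13 : 0 ≤ z1 ^ 3 := by positivity
  set z : ℝ := L ^ ((1:ℝ)/3) with hz
  have hzL : L = z ^ 3 := by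
    rw [hz, ← Real.rpow_natCast, ← Real.rpow_mul (by linarith)]; norm_num
  have hzz : z1 ≤ z := by
    have : z1 = (z1 ^ 3) ^ ((1:ℝ)/3) := by
      rw [← Real.rpow_natCast, ← Real.rpow_mul hz10]; norm_num
    rw [this, hz]
    gcongr
    linarith
  have haz : b + 2 ≤ Real.exp z := by
    have : b + 2 = a := by rw [hb]; ring
    rw [this]
    refine hay.trans (Real.exp_le_exp.mpr ?_)
    rw [hz]
    have : 0 ≤ Real.log y := by linarith
    gcongr
  set S : Finset ℕ := (Finset.range (⌈Real.exp (L + L / b)⌉₊)).filter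
    (fun n => Real.exp L ≤ n ∧ (n:ℝ) < Real.exp (L + L / b)) with hSdef
  have hS : ∀ n : ℕ, n ∈ S ↔ Real.exp L ≤ n ∧ (n:ℝ) < Real.exp (L + L / b) := by
    intro n
    rw [hSdef, Finset.mem_filter, Finset.mem_range]
    exact ⟨fun h => h.2, fun h => ⟨Nat.lt_ceil.mpr h.2, h⟩⟩
  have key := H z hzz b L S hb1 haz hzL hS
  have hset : {p : ℕ | p.Prime ∧ Real.exp L ≤ (p : ℝ) ∧ (p : ℝ) < Real.exp (L + L / b)} =
      ((S.filter Nat.Prime : Finset ℕ) : Set ℕ) := by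
    ext p
    simp only [Set.mem_ofPred_eq, Finset.coe_filter, hS]
    tauto
  rw [hset, finprod_mem_coe_finset]
  have hprod : ∏ p ∈ S.filter Nat.Prime, ((p:ℝ) / (p + 1)) = Real.exp (-∑ p ∈ S with p.Prime, Real.log (1 + 1 / (p:ℝ))) := by
    rw [← Finset.sum_neg_distrib, Real.exp_sum]
    refine Finset.prod_congr rfl fun p hp => ?_
    have hp0 : (0:ℝ) < p := by exact_mod_cast (Finset.mem_filter.mp hp).2.pos
    rw [Real.exp_neg, Real.exp_log (by positivity)]
    field_simp
  rw [hprod]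
  have h1 : Real.exp (-∑ p ∈ S with p.Prime, Real.log (1 + 1 / (p:ℝ))) ≤ (b + 1) / (b + 2) := by
    calc _ ≤ Real.exp (-Real.log ((b + 2) / (b + 1))) := by gcongr
      _ = (b + 1) / (b + 2) := by rw [Real.exp_neg, Real.exp_log (by positivity), inv_div]
  have h2 : (b + 1) / (b + 2) = 1 - 1 / a := by
    have : (a:ℝ) = b + 2 := by rw [hb]; ring
    rw [this]; field_simp; ring
  linarith

theorem statement19 :
    ∃ y₀ : ℝ, ∀ y : ℝ, y₀ ≤ y → ∀ a : ℤ, 3 ≤ a →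
      (a : ℝ) ≤ Real.exp (Real.log y ^ ((1:ℝ)/3)) →
      ∀ lam : ℝ, 1 < lam → y ≤ lam ^ (a - 2) →
      1 / (a : ℝ)
        ≤ 1 - ∏ᶠ p ∈ {p : ℕ | p.Prime ∧ lam ^ (a - 2) ≤ (p : ℝ) ∧ (p : ℝ) < lam ^ (a - 1)},
            ((p : ℝ) / ((p : ℝ) + 1)) := by
  exact final_aux
end
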